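/- arXiv:2203.16978 — 11 statements merged into one kernel-verified Lean document; each statement's English description precedes it below -/
import Mathlib

section
/- Let F be a field, n ≥ 1, and let M be an n×n matrix over the free noncommutative polynomial ring F⟨x₁,…,x_n⟩ (entries arbitrary noncommutative polynomials). Then there exist ℓ ≥ 0 and matrices P, L, Q of size (n+ℓ)×(n+ℓ) over F⟨x₁,…,x_n⟩ such that the block-diagonal matrix M ⊕ I_ℓ equals P·L·Q, where L is a linear matrix, P is upper triangular with all diagonal entries equal to 1, and Q is lower triangular with all diagonal entries equal to 1 (in particular P and Q are units of the matrix ring). -/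
/-- A (possibly rectangular) matrix over the free algebra `F⟨x₁,…,x_n⟩` is *linear* if it has
the form `A₀ + A₁x₁ + ⋯ + A_nx_n` where each `Aᵢ` is a scalar matrix over `F`. -/
def Matrix.IsLinearMat (F : Type*) [Field F] {n a b : ℕ}
    (L : Matrix (Fin a) (Fin b) (FreeAlgebra F (Fin n))) : Prop :=
  ∃ (A₀ : Matrix (Fin a) (Fin b) F) (A : Fin n → Matrix (Fin a) (Fin b) F),
    ∀ i j, L i j = algebraMap F (FreeAlgebra F (Fin n)) (A₀ i j) +
      ∑ t : Fin n, A t i j • FreeAlgebra.ι F t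

open Matrix

/-- The `F`-subspace of the free algebra spanned by `1` and the generators. -/
def FreeAlgebra.affineSpan (F : Type*) [Field F] (n : ℕ) : Submodule F (FreeAlgebra F (Fin n)) :=
  Submodule.span F {1} ⊔ Submodule.span F (Set.range (FreeAlgebra.ι F))

theorem FreeAlgebra.one_mem_affineSpan (F : Type*) [Field F] (n : ℕ) :
    (1 : FreeAlgebra F (Fin n)) ∈ FreeAlgebra.affineSpan F n :=
  Submodule.mem_sup_left (Submodule.mem_span_singleton_self 1)

theorem FreeAlgebra.ι_mem_affineSpan (F : Type*) [Field F] {n : ℕ} (t : Fin n) :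
    FreeAlgebra.ι F t ∈ FreeAlgebra.affineSpan F n :=
  Submodule.mem_sup_right (Submodule.subset_span ⟨t, rfl⟩)

theorem Matrix.IsLinearMat.of_forall_mem {F : Type*} [Field F] {n a b : ℕ}
    {L : Matrix (Fin a) (Fin b) (FreeAlgebra F (Fin n))}
    (h : ∀ i j, L i j ∈ FreeAlgebra.affineSpan F n) : Matrix.IsLinearMat F L := by
  have key : ∀ i j, ∃ (c₀ : F) (c : Fin n → F),
      L i j = algebraMap F _ c₀ + ∑ t, c t • FreeAlgebra.ι F t := by
    intro i j
    obtain ⟨y, hy, z, hz, hyz⟩ := Submodule.mem_sup.mp (h i j)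
    obtain ⟨c₀, rfl⟩ := Submodule.mem_span_singleton.mp hy
    obtain ⟨c, rfl⟩ := (Submodule.mem_span_range_iff_exists_fun F).mp hz
    exact ⟨c₀, c, by rw [← hyz, Algebra.algebraMap_eq_smul_one]⟩
  choose A₀ A hA using key
  exact ⟨A₀, fun t i j => A i j t, hA⟩

namespace Matrix

/-- A square matrix is upper unitriangular with respect to an enumeration `e` of its indices. -/
def IsUpperUnitriangular {S ι κ : Type*} [Zero S] [One S] [LT κ] (e : ι → κ)
    (U : Matrix ι ι S) : Prop :=
  BlockTriangular U e ∧ ∀ i, U i i = 1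

/-- Concatenation of enumerations of two index types. -/
def sumEnum {ι κ : Type*} {k l : ℕ} (e : ι ≃ Fin k) (f : κ ≃ Fin l) : ι ⊕ κ ≃ Fin (k + l) :=
  (Equiv.sumCongr e f).trans finSumFinEquiv

theorem isUpperUnitriangular_one {S ι : Type*} [Zero S] [One S] [DecidableEq ι] {k : ℕ}
    (e : ι ≃ Fin k) : IsUpperUnitriangular e (1 : Matrix ι ι S) :=
  ⟨blockTriangular_one, fun _ => one_apply_eq _⟩

theorem IsUpperUnitriangular.fromBlocks {S ι κ : Type*} [Zero S] [One S] {k l : ℕ}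
    {e : ι ≃ Fin k} {f : κ ≃ Fin l} {A : Matrix ι ι S} {D : Matrix κ κ S}
    (hA : IsUpperUnitriangular e A) (hD : IsUpperUnitriangular f D) (B : Matrix ι κ S) :
    IsUpperUnitriangular (sumEnum e f) (fromBlocks A B 0 D) := by
  refine ⟨?_, ?_⟩
  · rintro (i | i) (j | j) hij
    · exact hA.1 hij
    · simp only [sumEnum, Equiv.trans_apply, Equiv.sumCongr_apply, Sum.map_inl, Sum.map_inr,
        finSumFinEquiv_apply_left, finSumFinEquiv_apply_right, Fin.lt_def, Fin.val_castAdd,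
        Fin.val_natAdd] at hij
      omega
    · rfl
    · exact hD.1 (by simpa [sumEnum] using hij)
  · rintro (i | i)
    · exact hA.2 i
    · exact hD.2 i

/-- `M` is a Schur complement `A - B * U⁻¹ * C` of a block matrix with entries in
`FreeAlgebra.affineSpan F n`, where `U⁻¹` stands for an upper unitriangular left inverse `V` of `U`. -/
def HasLinearRealization {F : Type*} [Field F] {n a : ℕ}
    (M : Matrix (Fin a) (Fin a) (FreeAlgebra F (Fin n))) : Prop :=
  ∃ (ι : Type) (_ : Fintype ι) (_ : DecidableEq ι) (k : ℕ) (e : ι ≃ Fin k)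
    (A : Matrix (Fin a) (Fin a) (FreeAlgebra F (Fin n)))
    (B : Matrix (Fin a) ι (FreeAlgebra F (Fin n)))
    (C : Matrix ι (Fin a) (FreeAlgebra F (Fin n)))
    (U V : Matrix ι ι (FreeAlgebra F (Fin n))),
    (∀ i j, fromBlocks A B C U i j ∈ FreeAlgebra.affineSpan F n) ∧
    IsUpperUnitriangular e V ∧ V * U = 1 ∧ M = A - B * V * C

namespace HasLinearRealization

variable {F : Type*} [Field F] {n a : ℕ} {M N : Matrix (Fin a) (Fin a) (FreeAlgebra F (Fin n))}

theorem of_forall_mem (h : ∀ i j, M i j ∈ FreeAlgebra.affineSpan F n) :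
    HasLinearRealization M := by
  refine ⟨Fin 0, inferInstance, inferInstance, 0, Equiv.refl _, M, 0, 0, 1, 1, ?_,
    isUpperUnitriangular_one _, one_mul _, by simp⟩
  rintro (i | i) (j | j)
  · exact h i j
  · exact j.elim0
  · exact i.elim0
  · exact i.elim0

theorem add (hM : HasLinearRealization M) (hN : HasLinearRealization N) :
    HasLinearRealization (M + N) := by
  obtain ⟨ι, _, _, k, e, A, B, C, U, V, hL, hV, hVU, rfl⟩ := hM
  obtain ⟨κ, _, _, l, f, A', B', C', U', V', hL', hV', hVU', rfl⟩ := hN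
  refine ⟨ι ⊕ κ, inferInstance, inferInstance, k + l, sumEnum e f, A + A', fromCols B B',
    fromRows C C', fromBlocks U 0 0 U', fromBlocks V 0 0 V', ?_, hV.fromBlocks hV' 0, ?_, ?_⟩
  · rintro (i | i | i) (j | j | j)
    · exact add_mem (hL (.inl i) (.inl j)) (hL' (.inl i) (.inl j))
    · exact hL (.inl i) (.inr j)
    · exact hL' (.inl i) (.inr j)
    · exact hL (.inr i) (.inl j)
    · exact hL (.inr i) (.inr j)
    · exact zero_mem _
    · exact hL' (.inr i) (.inl j)
    · exact zero_mem _
    · exact hL' (.inr i) (.inr j)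
  · simp [fromBlocks_multiply, hVU, hVU']
  · rw [fromCols_mul_fromBlocks, fromCols_mul_fromRows]
    simp only [Matrix.mul_zero, add_zero, zero_add]
    abel

theorem sum {σ : Type*} (s : Finset σ) {f : σ → Matrix (Fin a) (Fin a) (FreeAlgebra F (Fin n))}
    (h : ∀ i ∈ s, HasLinearRealization (f i)) : HasLinearRealization (∑ i ∈ s, f i) :=
  Finset.sum_induction f HasLinearRealization (fun _ _ => add)
    (of_forall_mem fun _ _ => zero_mem _) h

theorem smul_of_mem {x : FreeAlgebra F (Fin n)} (hx : x ∈ FreeAlgebra.affineSpan F n)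
    (hM : HasLinearRealization M) : HasLinearRealization (x • M) := by
  obtain ⟨ι, _, _, k, e, A, B, C, U, V, hL, hV, hVU, rfl⟩ := hM
  refine ⟨Fin a ⊕ ι, inferInstance, inferInstance, a + k, sumEnum (Equiv.refl _) e, 0,
    fromCols (-(x • 1)) 0, fromRows A C, fromBlocks 1 B 0 U, fromBlocks 1 (-(B * V)) 0 V, ?_,
    (isUpperUnitriangular_one _).fromBlocks hV _, ?_, ?_⟩
  · rintro (i | i | i) (j | j | j)
    · exact zero_mem _
    · refine neg_mem ?_
      rw [smul_apply, one_apply]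
      split_ifs <;> simp [hx]
    · exact zero_mem _
    · exact hL (.inl i) (.inl j)
    · change (1 : Matrix (Fin a) (Fin a) (FreeAlgebra F (Fin n))) i j ∈ _
      rw [one_apply]
      split_ifs
      · exact FreeAlgebra.one_mem_affineSpan F n
      · exact zero_mem _
    · exact hL (.inl i) (.inr j)
    · exact hL (.inr i) (.inl j)
    · exact zero_mem _
    · exact hL (.inr i) (.inr j)
  · simp [fromBlocks_multiply, hVU, Matrix.mul_assoc]
  · rw [fromCols_mul_fromBlocks, fromCols_mul_fromRows]
    simp [sub_eq_add_neg, add_comm, Matrix.mul_assoc]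

theorem smul (p : FreeAlgebra F (Fin n)) (hM : HasLinearRealization M) :
    HasLinearRealization (p • M) := by
  induction p using FreeAlgebra.induction generalizing M with
  | grade0 r =>
    refine smul_of_mem ?_ hM
    rw [Algebra.algebraMap_eq_smul_one]
    exact Submodule.smul_mem _ _ (FreeAlgebra.one_mem_affineSpan F n)
  | grade1 t => exact smul_of_mem (FreeAlgebra.ι_mem_affineSpan F t) hM
  | mul p q hp hq => rw [mul_smul]; exact hp (hq hM)
  | add p q hp hq => rw [add_smul]; exact (hp hM).add (hq hM)

end HasLinearRealization

/-- Every matrix over the free algebra is a Schur complement of a linear matrix. -/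
theorem hasLinearRealization {F : Type*} [Field F] {n a : ℕ}
    (M : Matrix (Fin a) (Fin a) (FreeAlgebra F (Fin n))) : HasLinearRealization M := by
  rw [matrix_eq_sum_single M]
  refine .sum _ fun i _ => .sum _ fun j _ => ?_
  have h : single i j (M i j) = M i j • single i j 1 := by simp [smul_single]
  rw [h]
  refine .smul _ (.of_forall_mem fun r s => ?_)
  rw [single_apply]
  split_ifs
  · exact FreeAlgebra.one_mem_affineSpan F n
  · exact zero_mem _

theorem fromBlocks_schur_factorization {S ι κ : Type*} [Ring S] [Fintype ι] [Fintype κ]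
    [DecidableEq ι] [DecidableEq κ] (A : Matrix ι ι S) (B : Matrix ι κ S) (C : Matrix κ ι S)
    {U V : Matrix κ κ S} (hVU : V * U = 1) :
    fromBlocks (A - B * V * C) 0 0 (1 : Matrix κ κ S) =
      fromBlocks 1 (-(B * V)) 0 V * fromBlocks A B C U * fromBlocks 1 0 (-(V * C)) 1 := by
  simp only [fromBlocks_multiply, Matrix.one_mul, Matrix.mul_one, Matrix.zero_mul,
    Matrix.mul_zero, Matrix.neg_mul, Matrix.mul_neg, Matrix.mul_assoc, zero_add, hVU,
    add_neg_cancel, neg_zero, add_zero, sub_eq_add_neg]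

end Matrix

/-- Higman linearization: for any `n × n` matrix `M` over `F⟨x₁,…,x_n⟩` there are `ℓ ≥ 0` and
`(n+ℓ) × (n+ℓ)` matrices `P, L, Q` with `M ⊕ I_ℓ = P·L·Q`, `L` linear, `P` upper triangular with
all-ones diagonal and `Q` lower triangular with all-ones diagonal. -/
theorem higman_linearization (F : Type*) [Field F] (n : ℕ) (hn : 1 ≤ n)
    (M : Matrix (Fin n) (Fin n) (FreeAlgebra F (Fin n))) :
    ∃ (ℓ : ℕ) (P L Q : Matrix (Fin (n + ℓ)) (Fin (n + ℓ)) (FreeAlgebra F (Fin n))),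
      Matrix.IsLinearMat F L ∧
      (∀ i j : Fin (n + ℓ), j < i → P i j = 0) ∧ (∀ i : Fin (n + ℓ), P i i = 1) ∧
      (∀ i j : Fin (n + ℓ), i < j → Q i j = 0) ∧ (∀ i : Fin (n + ℓ), Q i i = 1) ∧
      Matrix.reindex finSumFinEquiv finSumFinEquiv
        (Matrix.fromBlocks M 0 0 (1 : Matrix (Fin ℓ) (Fin ℓ) (FreeAlgebra F (Fin n))))
        = P * L * Q := by
  obtain ⟨ι, _, _, k, e, A, B, C, U, V, hL, hV, hVU, hM⟩ := M.hasLinearRealization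
  set g := sumEnum (Equiv.refl (Fin n)) e
  have hP : IsUpperUnitriangular g (fromBlocks 1 (-(B * V)) 0 V) :=
    (isUpperUnitriangular_one _).fromBlocks hV _
  have hQ : IsUpperUnitriangular g (fromBlocks 1 0 (-(V * C)) 1)ᵀ := by
    rw [fromBlocks_transpose, transpose_one, transpose_one, transpose_zero]
    exact (isUpperUnitriangular_one _).fromBlocks (isUpperUnitriangular_one _) _
  refine ⟨k, reindex g g (fromBlocks 1 (-(B * V)) 0 V), reindex g g (fromBlocks A B C U),
    reindex g g (fromBlocks 1 0 (-(V * C)) 1), .of_forall_mem fun i j => hL _ _,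
    fun i j hij => hP.1 (by simpa using hij), fun i => hP.2 _,
    fun i j hij => hQ.1 (by simpa using hij), fun i => hQ.2 _, ?_⟩
  simp only [reindex_apply, submatrix_mul_equiv]
  rw [← fromBlocks_schur_factorization A B C hVU, ← hM]
  have hg : (g.symm : Fin (n + k) → Fin n ⊕ ι) = Sum.map id e.symm ∘ finSumFinEquiv.symm := by
    funext i
    simp [g, sumEnum]
  rw [hg, ← submatrix_submatrix]
  congr 1
  ext (i | i) (j | j) <;> simp [one_apply]
end

section
/- Let F be a finite field and let L = A₀ + A₁x₁ + ⋯ + A_nx_n be a d×d linear matrix over F⟨x₁,…,x_n⟩ that is full, not a unit, and right monic, meaning the d×(nd) scalar block matrix [A₁ A₂ ⋯ A_n] has rank d over F. Then there exist r ≥ 1 and d×d linear matrices F₁, F₂, …, F_r over F⟨x₁,…,x_n⟩, each of which is an atom, such that L = F₁·F₂⋯F_r. -/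
/-- A square matrix `M` over a ring `R` is *full* if it cannot be written as a product
`A·B` with `A` of size `d × r`, `B` of size `r × d` and `r < d`. -/
def Matrix.IsFullMat {R : Type*} [Ring R] {d : ℕ} (M : Matrix (Fin d) (Fin d) R) : Prop :=
  ¬ ∃ (r : ℕ) (_ : r < d) (A : Matrix (Fin d) (Fin r) R) (B : Matrix (Fin r) (Fin d) R),
      M = A * B

/-- A full non-unit square matrix `M` is an *atom* if in any factorization `M = A·B`
one of the factors is a unit of the matrix ring. -/
def Matrix.IsAtomMat {R : Type*} [Ring R] {d : ℕ} (M : Matrix (Fin d) (Fin d) R) : Prop :=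
  Matrix.IsFullMat M ∧ ¬ IsUnit M ∧
    ∀ A B : Matrix (Fin d) (Fin d) R, M = A * B → IsUnit A ∨ IsUnit B

namespace FreeAlgebra

variable {F X : Type*} [Field F] [DecidableEq X]

/-- The representation `a ↦ !![ε a, ∂ₓ a; 0, a]` of the free algebra, where `ε` is the augmentation
and `∂ₓ` strips a leading letter `x`. -/
noncomputable def transductionHom (x : X) :
    FreeAlgebra F X →ₐ[F] Matrix (Fin 2) (Fin 2) (FreeAlgebra F X) :=
  lift F fun y => !![0, if x = y then 1 else 0; 0, ι F y]

/-- Left transduction by `x`: every word `x * w` is sent to `w`, all other words to `0`. -/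
noncomputable def transduction (x : X) : FreeAlgebra F X →ₗ[F] FreeAlgebra F X :=
  (LinearMap.proj 1 ∘ₗ LinearMap.proj 0) ∘ₗ
    (Matrix.ofLinearEquiv F).symm.toLinearMap ∘ₗ (transductionHom x).toLinearMap

lemma transduction_apply (x : X) (a : FreeAlgebra F X) :
    transduction x a = transductionHom x a 0 1 := rfl

lemma transductionHom_entries (x : X) (a : FreeAlgebra F X) :
    transductionHom x a 0 0 = algebraMap F _ (algebraMapInv a) ∧
      transductionHom x a 1 0 = 0 ∧ transductionHom x a 1 1 = a := by
  induction a using FreeAlgebra.induction with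
  | grade0 r => simp [Matrix.algebraMap_matrix_apply, algebraMapInv]
  | grade1 y => simp [transductionHom, algebraMapInv]
  | mul a b ha hb =>
    obtain ⟨ha₁, ha₂, ha₃⟩ := ha
    obtain ⟨hb₁, hb₂, hb₃⟩ := hb
    simp [Matrix.mul_apply, Fin.sum_univ_two, *]
  | add a b ha hb =>
    obtain ⟨ha₁, ha₂, ha₃⟩ := ha
    obtain ⟨hb₁, hb₂, hb₃⟩ := hb
    simp [*]

lemma transduction_mul (x : X) (a b : FreeAlgebra F X) :
    transduction x (a * b) = transduction x a * b + algebraMapInv a • transduction x b := by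
  simp only [transduction_apply, map_mul, Matrix.mul_apply, Fin.sum_univ_two,
    (transductionHom_entries x a).1, (transductionHom_entries x b).2.2, Algebra.smul_def]
  rw [add_comm]

@[simp]
lemma transduction_algebraMap (x : X) (r : F) :
    transduction x (algebraMap F (FreeAlgebra F X) r) = 0 := by
  simp [transduction_apply, Matrix.algebraMap_matrix_apply]

@[simp]
lemma transduction_one (x : X) : transduction x (1 : FreeAlgebra F X) = 0 := by
  simpa using transduction_algebraMap x (1 : F)

@[simp]
lemma transduction_ι (x y : X) : transduction x (ι F y) = if x = y then 1 else 0 := by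
  simp [transduction_apply, transductionHom]

lemma eq_algebraMapInv_add_sum_transduction [Fintype X] (a : FreeAlgebra F X) :
    a = algebraMap F _ (algebraMapInv a) + ∑ x, ι F x * transduction x a := by
  induction a using FreeAlgebra.induction with
  | grade0 r => simp [algebraMapInv]
  | grade1 y => simp [algebraMapInv]
  | mul a b ha hb =>
    have h : ∑ x, ι F x * transduction x (a * b) =
        (∑ x, ι F x * transduction x a) * b +
          algebraMapInv a • ∑ x, ι F x * transduction x b := by
      simp only [transduction_mul, mul_add, Finset.sum_add_distrib, Finset.sum_mul, mul_assoc,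
        Finset.smul_sum, mul_smul_comm]
    have ha' := eq_sub_of_add_eq' ha.symm
    have hb' := eq_sub_of_add_eq' hb.symm
    rw [h, ha', hb', Algebra.smul_def, map_mul, map_mul]
    noncomm_ring
  | add a b ha hb =>
    simp only [map_add, mul_add, Finset.sum_add_distrib]
    nth_rewrite 1 [ha]
    nth_rewrite 1 [hb]
    abel

/-- The elements of the free algebra of degree less than `k`. -/
noncomputable def degLT (F X : Type*) [Field F] [DecidableEq X] :
    ℕ → Submodule F (FreeAlgebra F X)
  | 0 => ⊥
  | k + 1 => ⨅ x, (degLT F X k).comap (transduction x)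

lemma mem_degLT_zero {a : FreeAlgebra F X} : a ∈ degLT F X 0 ↔ a = 0 := by
  simp [degLT]

lemma mem_degLT_succ {a : FreeAlgebra F X} {k : ℕ} :
    a ∈ degLT F X (k + 1) ↔ ∀ x, transduction x a ∈ degLT F X k := by
  simp [degLT]

lemma degLT_mono : Monotone (degLT F X) := by
  refine monotone_nat_of_le_succ fun k => ?_
  induction k with
  | zero => simp [degLT]
  | succ k ih => exact fun a ha => mem_degLT_succ.2 fun x => ih (mem_degLT_succ.1 ha x)

lemma transduction_mem_degLT {a : FreeAlgebra F X} {k : ℕ} (ha : a ∈ degLT F X k) (x : X) :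
    transduction x a ∈ degLT F X (k - 1) := by
  cases k with
  | zero => simp [mem_degLT_zero.1 ha]
  | succ k => exact mem_degLT_succ.1 ha x

lemma mul_mem_degLT {k l : ℕ} {a b : FreeAlgebra F X} (ha : a ∈ degLT F X k)
    (hb : b ∈ degLT F X l) : a * b ∈ degLT F X (k + l) := by
  induction k generalizing a with
  | zero => simp [mem_degLT_zero.1 ha]
  | succ k ih =>
    rw [Nat.succ_add_eq_add_succ, Nat.succ_eq_add_one, ← add_assoc]
    refine mem_degLT_succ.2 fun x => ?_
    rw [transduction_mul]
    exact add_mem (ih (mem_degLT_succ.1 ha x)) (Submodule.smul_mem _ _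
      (degLT_mono (by omega) (transduction_mem_degLT hb x)))

lemma exists_mem_degLT (a : FreeAlgebra F X) : ∃ k, a ∈ degLT F X k := by
  induction a using FreeAlgebra.induction with
  | grade0 r => exact ⟨1, mem_degLT_succ.2 fun x => by simp⟩
  | grade1 y =>
    refine ⟨2, mem_degLT_succ.2 fun x => mem_degLT_succ.2 fun z => ?_⟩
    rw [transduction_ι]
    split_ifs <;> simp
  | mul a b ha hb =>
    obtain ⟨k, hk⟩ := ha
    obtain ⟨l, hl⟩ := hb
    exact ⟨k + l, mul_mem_degLT hk hl⟩
  | add a b ha hb =>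
    obtain ⟨k, hk⟩ := ha
    obtain ⟨l, hl⟩ := hb
    exact ⟨max k l, add_mem (degLT_mono (le_max_left k l) hk) (degLT_mono (le_max_right k l) hl)⟩

lemma exists_forall_mem_degLT {κ : Type*} [Finite κ] (v : κ → FreeAlgebra F X) :
    ∃ k, ∀ i, v i ∈ degLT F X k := by
  choose k hk using fun i => exists_mem_degLT (v i)
  obtain ⟨K, hK⟩ := (Set.finite_range k).bddAbove
  exact ⟨K, fun i => degLT_mono (hK ⟨i, rfl⟩) (hk i)⟩

lemma eq_algebraMap_of_transduction_eq_zero [Fintype X] {a : FreeAlgebra F X}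
    (h : ∀ x, transduction x a = 0) : a = algebraMap F _ (algebraMapInv a) := by
  simpa [h] using eq_algebraMapInv_add_sum_transduction a

lemma eq_of_mem_degLT_two [Fintype X] {a : FreeAlgebra F X} (ha : a ∈ degLT F X 2) :
    a = algebraMap F _ (algebraMapInv a) +
      ∑ x, algebraMapInv (transduction x a) • ι F x := by
  refine (eq_algebraMapInv_add_sum_transduction a).trans ?_
  congr 1
  refine Finset.sum_congr rfl fun x _ => ?_
  rw [eq_algebraMap_of_transduction_eq_zero (a := transduction x a) fun y =>
    mem_degLT_zero.1 (mem_degLT_succ.1 (mem_degLT_succ.1 ha x) y), ← Algebra.commutes,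
    ← Algebra.smul_def]
  simp [algebraMapInv]

lemma linear_mem_degLT_two [Fintype X] (r : F) (c : X → F) :
    algebraMap F _ r + ∑ x, c x • ι F x ∈ degLT F X 2 := by
  refine mem_degLT_succ.2 fun y => mem_degLT_succ.2 fun z => mem_degLT_zero.2 ?_
  simp

end FreeAlgebra

namespace Matrix

open FreeAlgebra

section Reduced

variable {F X p m : Type*} [Field F] [DecidableEq X] [Fintype p]

/-- The rows of `B`, of degrees less than `k i`, are *reduced* if no nonzero row can be lowered in
degree by adding to it a left combination of the other rows. -/
def IsRowReduced (B : Matrix p m (FreeAlgebra F X)) (k : p → ℕ) : Prop :=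
  (∀ i j, B i j ∈ degLT F X (k i)) ∧
    ∀ i (u : p → FreeAlgebra F X), k i ≠ 0 → u i = 1 →
      ¬ ∀ j, (u ᵥ* B) j ∈ degLT F X (k i - 1)

/-- For a reduced matrix the degree of `u * B` is the maximum of the degrees of `u i * B i`. -/
lemma IsRowReduced.mem_degLT [Fintype X] {B : Matrix p m (FreeAlgebra F X)} {k : p → ℕ}
    (hB : IsRowReduced B k) {u : p → FreeAlgebra F X} {D : ℕ}
    (hu : ∀ j, (u ᵥ* B) j ∈ degLT F X D) (i : p) (hi : k i ≠ 0) :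
    u i ∈ degLT F X (D + 1 - k i) := by
  obtain ⟨N, hN⟩ := exists_forall_mem_degLT u
  induction N generalizing u D i with
  | zero => simp [mem_degLT_zero.1 (hN i)]
  | succ N ih =>
    have key : ∀ D', D - 1 ≤ D' → (∀ i, algebraMapInv (u i) ≠ 0 → k i - 1 ≤ D') →
        ∀ x i, k i ≠ 0 → transduction x (u i) ∈ degLT F X (D' + 1 - k i) := by
      intro D' hD' hk x i hi
      refine ih (u := fun i => transduction x (u i)) (fun j => ?_) i hi
        fun i => mem_degLT_succ.1 (hN i) x
      have h : ((fun i => transduction x (u i)) ᵥ* B) j =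
          transduction x ((u ᵥ* B) j) - ∑ i, algebraMapInv (u i) • transduction x (B i j) := by
        simp [vecMul, dotProduct, transduction_mul, Finset.sum_add_distrib]
      rw [h]
      refine sub_mem (degLT_mono hD' (transduction_mem_degLT (hu j) x)) (sum_mem fun i _ => ?_)
      by_cases h0 : algebraMapInv (u i) = 0
      · simp [h0]
      · exact Submodule.smul_mem _ _
          (degLT_mono (hk i h0) (transduction_mem_degLT (hB.1 i j) x))
    by_cases hlow : ∀ i, algebraMapInv (u i) ≠ 0 → k i ≤ D
    · have h := key (D - 1) le_rfl (fun i h0 => Nat.sub_le_sub_right (hlow i h0) 1)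
      by_cases hiD : k i ≤ D
      · rw [Nat.sub_add_comm hiD]
        exact mem_degLT_succ.2 fun x => degLT_mono (by omega) (h x i hi)
      · have h0 : algebraMapInv (u i) = 0 := by
          by_contra h0
          exact hiD (hlow i h0)
        have hz := eq_algebraMap_of_transduction_eq_zero (a := u i) fun x =>
          mem_degLT_zero.1 (degLT_mono (by omega) (h x i hi))
        rw [hz, h0]
        simp
    · exfalso
      classical
      simp only [not_forall, not_le] at hlow
      obtain ⟨i₁, hi₁, hk₁⟩ := hlow
      obtain ⟨i₀, hi₀, hmax⟩ := Finset.exists_max_image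
        (Finset.univ.filter fun i => algebraMapInv (u i) ≠ 0) k ⟨i₁, by simpa using hi₁⟩
      have hc : algebraMapInv (u i₀) ≠ 0 := (Finset.mem_filter.1 hi₀).2
      have hk₀ : D < k i₀ := hk₁.trans_le (hmax i₁ (by simpa using hi₁))
      have h := key (k i₀ - 1) (by omega) fun i h0 =>
        Nat.sub_le_sub_right (hmax i (by simpa using h0)) 1
      have hz := eq_algebraMap_of_transduction_eq_zero (a := u i₀) fun x =>
        mem_degLT_zero.1 (degLT_mono (by omega) (h x i₀ (by omega)))
      refine hB.2 i₀ ((algebraMapInv (u i₀))⁻¹ • u) (by omega) ?_ fun j => ?_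
      · rw [Pi.smul_apply]
        nth_rewrite 2 [hz]
        rw [Algebra.smul_def, ← map_mul, inv_mul_cancel₀ hc, map_one]
      · rw [smul_vecMul]
        exact Submodule.smul_mem _ _ (degLT_mono (by omega) (hu j))

variable [DecidableEq p]

lemma isUnit_updateRow_one {R : Type*} [Ring R] (i : p) (u : p → R) (hu : u i = 1) :
    IsUnit (updateRow (1 : Matrix p p R) i u) := by
  set N : Matrix p p R := updateRow 1 i u - 1 with hN
  have hrow : ∀ a b, a ≠ i → N a b = 0 := fun a b h => by simp [hN, h]
  have hcol : ∀ a, N a i = 0 := fun a => by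
    by_cases h : a = i
    · subst h; simp [hN, hu]
    · exact hrow a i h
  have hsq : N ^ 2 = 0 := by
    ext a b
    rw [sq, mul_apply]
    refine Finset.sum_eq_zero fun j _ => ?_
    by_cases h : j = i
    · simp [h, hcol]
    · simp [hrow j b h]
  have := IsNilpotent.isUnit_one_add (r := N) ⟨2, hsq⟩
  rwa [hN, add_sub_cancel] at this

lemma exists_isRowReduced [Finite m] (B : Matrix p m (FreeAlgebra F X)) :
    ∃ (U : (Matrix p p (FreeAlgebra F X))ˣ) (k : p → ℕ), IsRowReduced (U.val * B) k := by
  choose k hk using fun i => exists_forall_mem_degLT (B i)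
  induction hs : ∑ i, k i using Nat.strong_induction_on generalizing B k with
  | _ s ih =>
    by_cases hred : IsRowReduced B k
    · exact ⟨1, k, by simpa using hred⟩
    · obtain ⟨i, u, hki, hui, hu⟩ : ∃ i u, k i ≠ 0 ∧ u i = 1 ∧
          ∀ j, (u ᵥ* B) j ∈ degLT F X (k i - 1) := by
        by_contra! hno
        exact hred ⟨hk, fun i u hi hui hu => (hno i u hi hui).elim fun j hj => hj (hu j)⟩
      obtain ⟨E, hE⟩ := isUnit_updateRow_one i u hui
      have hlt : ∑ j, Function.update k i (k i - 1) j < s := by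
        rw [← hs]
        refine Finset.sum_lt_sum (fun j _ => ?_) ⟨i, Finset.mem_univ i, ?_⟩
        · by_cases h : j = i
          · subst h; simp
          · simp [h]
        · simp; omega
      obtain ⟨U, l, hU⟩ := ih _ hlt (E.val * B) (Function.update k i (k i - 1)) (fun a j => by
        rw [hE, updateRow_mul]
        by_cases h : a = i
        · subst h; simp [hu]
        · simpa [h] using hk a j) rfl
      exact ⟨U * E, l, by simpa [Matrix.mul_assoc] using hU⟩

end Reduced

section Full

variable {R : Type*} [Ring R] {d : ℕ}

lemma IsFullMat.of_mul_left {A B : Matrix (Fin d) (Fin d) R} (h : IsFullMat (A * B)) :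
    IsFullMat B := by
  rintro ⟨r, hr, C, D, rfl⟩
  exact h ⟨r, hr, A * C, D, (Matrix.mul_assoc _ _ _).symm⟩

lemma IsFullMat.of_mul_right {A B : Matrix (Fin d) (Fin d) R} (h : IsFullMat (A * B)) :
    IsFullMat A := by
  rintro ⟨r, hr, C, D, rfl⟩
  exact h ⟨r, hr, C, D * B, Matrix.mul_assoc _ _ _⟩

lemma IsFullMat.exists_ne_zero {A B : Matrix (Fin d) (Fin d) R} (h : IsFullMat (A * B))
    (j : Fin d) : ∃ i l, A i j * B j l ≠ 0 := by
  by_contra! hz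
  obtain _ | d := d
  · exact j.elim0
  · refine h ⟨d, d.lt_succ_self, A.submatrix id j.succAbove, B.submatrix j.succAbove id, ?_⟩
    ext i l
    simp [mul_apply, Fin.sum_univ_succAbove _ j, hz]

lemma IsAtomMat.mul_unit {M : Matrix (Fin d) (Fin d) R} (h : IsAtomMat M)
    (U : (Matrix (Fin d) (Fin d) R)ˣ) : IsAtomMat (M * U.val) := by
  obtain ⟨hf, hn, ha⟩ := h
  refine ⟨?_, by simpa using hn, fun A B hAB => ?_⟩
  · refine IsFullMat.of_mul_right (B := U⁻¹.val) ?_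
    simpa [Matrix.mul_assoc] using hf
  · have hM : M = A * (B * U⁻¹.val) := by
      rw [← Matrix.mul_assoc, ← hAB, Matrix.mul_assoc, Units.mul_inv, Matrix.mul_one]
    simpa using ha _ _ hM

end Full

section FreeAlgebra

variable {F X : Type*} [Field F] {d : ℕ}

lemma IsFullMat.ne_zero_of_isRowReduced [DecidableEq X]
    {A B : Matrix (Fin d) (Fin d) (FreeAlgebra F X)}
    {k : Fin d → ℕ} (h : IsFullMat (A * B)) (hB : IsRowReduced B k) (i : Fin d) : k i ≠ 0 := by
  intro hk
  obtain ⟨_, l, hl⟩ := h.exists_ne_zero i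
  have := hB.1 i l
  rw [hk, mem_degLT_zero] at this
  simp [this] at hl

variable [Fintype X]

/-- The coefficients of the linear row vectors in the left row space of `B`. -/
def linearRows (B : Matrix (Fin d) (Fin d) (FreeAlgebra F X)) :
    Set ((Fin d → F) × (X → Fin d → F)) :=
  {c | ∃ u, ∀ j, algebraMap F _ (c.1 j) + ∑ x, c.2 x j • ι F x = (u ᵥ* B) j}

lemma linearRows_mul_subset (A B : Matrix (Fin d) (Fin d) (FreeAlgebra F X)) :
    linearRows (A * B) ⊆ linearRows B := by
  rintro c ⟨u, hu⟩
  exact ⟨u ᵥ* A, fun j => by rw [hu, vecMul_vecMul]⟩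

variable [DecidableEq X]

/-- Full matrices over a free algebra can be cancelled on the right. -/
lemma IsFullMat.mul_right_cancel {A B C : Matrix (Fin d) (Fin d) (FreeAlgebra F X)}
    (hC : IsFullMat C) (h : A * C = B * C) : A = B := by
  obtain ⟨U, k, hU⟩ := exists_isRowReduced C
  have hC' : U⁻¹.val * (U.val * C) = C := by
    rw [← Matrix.mul_assoc, Units.inv_mul, Matrix.one_mul]
  have hk := IsFullMat.ne_zero_of_isRowReduced (A := U⁻¹.val) (hC'.symm ▸ hC) hU
  have hz : (A - B) * U⁻¹.val = 0 := by
    ext i j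
    have hrow : ∀ l, (((A - B) * U⁻¹.val) i ᵥ* (U.val * C)) l ∈ degLT F X 0 := fun l => by
      rw [mem_degLT_zero]
      change (((A - B) * U⁻¹.val) * (U.val * C)) i l = 0
      rw [Matrix.mul_assoc, hC', Matrix.sub_mul, h, sub_self, zero_apply]
    exact mem_degLT_zero.1 (degLT_mono (by have := hk j; omega) (hU.mem_degLT hrow j (hk j)))
  rwa [Units.mul_left_eq_zero, sub_eq_zero] at hz

/-- Any factorization of a full linear matrix becomes one into linear factors after inserting a
unit between the factors. -/
lemma IsFullMat.exists_unit_degLT_two {A B : Matrix (Fin d) (Fin d) (FreeAlgebra F X)}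
    (hfull : IsFullMat (A * B)) (hlin : ∀ i j, (A * B) i j ∈ degLT F X 2) :
    ∃ U : (Matrix (Fin d) (Fin d) (FreeAlgebra F X))ˣ,
      (∀ i j, (A * U⁻¹.val) i j ∈ degLT F X 2) ∧ ∀ i j, (U.val * B) i j ∈ degLT F X 2 := by
  obtain ⟨U, k, hU⟩ := exists_isRowReduced B
  have hAB : (A * U⁻¹.val) * (U.val * B) = A * B := by
    rw [Matrix.mul_assoc, ← Matrix.mul_assoc U⁻¹.val, Units.inv_mul, Matrix.one_mul]
  rw [← hAB] at hfull hlin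
  have hk := hfull.ne_zero_of_isRowReduced hU
  have hA : ∀ i j, (A * U⁻¹.val) i j ∈ degLT F X (2 + 1 - k j) := fun i j =>
    hU.mem_degLT (u := (A * U⁻¹.val) i) (hlin i) j (hk j)
  refine ⟨U, fun i j => degLT_mono (by have := hk j; omega) (hA i j), fun i j =>
    degLT_mono ?_ (hU.1 i j)⟩
  by_contra! hki
  obtain ⟨a, l, hal⟩ := hfull.exists_ne_zero i
  have := hA a i
  rw [show 2 + 1 - k i = 0 by omega, mem_degLT_zero] at this
  simp [this] at hal

lemma isUnit_of_linearRows_subset {A B C : Matrix (Fin d) (Fin d) (FreeAlgebra F X)}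
    (hfull : IsFullMat (C * (A * B))) (hlin : ∀ i j, (C * (A * B)) i j ∈ degLT F X 2)
    (hsub : linearRows B ⊆ linearRows (A * B)) : IsUnit A := by
  rw [← Matrix.mul_assoc] at hfull hlin
  obtain ⟨U, -, hU⟩ := hfull.exists_unit_degLT_two hlin
  have hrow : ∀ i, ∃ u, ∀ j, (U.val * B) i j = (u ᵥ* (A * B)) j := fun i => by
    obtain ⟨u, hu⟩ := hsub (a := (fun j => algebraMapInv ((U.val * B) i j),
      fun x j => algebraMapInv (transduction x ((U.val * B) i j))))
      ⟨U.val i, fun j => (eq_of_mem_degLT_two (hU i j)).symm⟩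
    exact ⟨u, fun j => (eq_of_mem_degLT_two (hU i j)).trans (hu j)⟩
  choose V hV using hrow
  have hUV : U.val * B = (of V * A) * B := by
    ext i j
    rw [hV i j, Matrix.mul_assoc]
    rfl
  have hVA : U.val = of V * A := hfull.of_mul_left.mul_right_cancel hUV
  have hinv : (U⁻¹.val * of V) * A = 1 := by rw [Matrix.mul_assoc, ← hVA, Units.inv_mul]
  refine ⟨⟨A, U⁻¹.val * of V, ?_, hinv⟩, rfl⟩
  refine hfull.of_mul_right.of_mul_left.mul_right_cancel ?_
  rw [Matrix.mul_assoc, hinv, Matrix.mul_one, Matrix.one_mul]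

lemma exists_linear_atom_mul [Finite F] {L : Matrix (Fin d) (Fin d) (FreeAlgebra F X)}
    (hfull : IsFullMat L) (hlin : ∀ i j, L i j ∈ degLT F X 2) (hL : ¬ IsUnit L) :
    ∃ A B, L = A * B ∧ IsAtomMat A ∧ (∀ i j, A i j ∈ degLT F X 2) ∧
      ∀ i j, B i j ∈ degLT F X 2 := by
  obtain ⟨S, ⟨A, B, hAB, hA, rfl⟩, hmin⟩ := wellFounded_lt.has_min
    {S | ∃ A B, L = A * B ∧ ¬ IsUnit A ∧ linearRows B = S} ⟨_, L, 1, by simp, hL, rfl⟩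
  have hAatom : IsAtomMat A := by
    refine ⟨(hAB ▸ hfull).of_mul_right, hA, fun C D hCD => ?_⟩
    by_contra! hn
    have hL' : L = C * (D * B) := by rw [hAB, hCD, Matrix.mul_assoc]
    refine hmin _ ⟨C, D * B, hL', hn.1, rfl⟩ ⟨linearRows_mul_subset D B, fun hsub => hn.2 ?_⟩
    exact isUnit_of_linearRows_subset (hL' ▸ hfull) (hL' ▸ hlin) hsub
  obtain ⟨U, hU₁, hU₂⟩ := (hAB ▸ hfull).exists_unit_degLT_two (hAB ▸ hlin)
  refine ⟨_, _, ?_, hAatom.mul_unit U⁻¹, hU₁, hU₂⟩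
  rw [Matrix.mul_assoc, ← Matrix.mul_assoc U⁻¹.val, Units.inv_mul, Matrix.one_mul, hAB]

/-- A full linear non-unit is a product of linear atoms. -/
lemma IsFullMat.exists_list_linear_atoms [Finite F]
    {L : Matrix (Fin d) (Fin d) (FreeAlgebra F X)} (hfull : IsFullMat L)
    (hlin : ∀ i j, L i j ∈ degLT F X 2) (hL : ¬ IsUnit L) :
    ∃ l : List (Matrix (Fin d) (Fin d) (FreeAlgebra F X)), l ≠ [] ∧
      (∀ M ∈ l, IsAtomMat M ∧ ∀ i j, M i j ∈ degLT F X 2) ∧ L = l.prod := by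
  have hwf : WellFounded ((· > ·) : Set ((Fin d → F) × (X → Fin d → F)) → _ → Prop) :=
    wellFounded_gt
  induction hS : linearRows L using hwf.induction generalizing L with
  | _ S ih =>
    obtain ⟨A, B, rfl, hA, hA₂, hB₂⟩ := exists_linear_atom_mul hfull hlin hL
    by_cases hB : IsUnit B
    · obtain ⟨U, rfl⟩ := hB
      exact ⟨[A * U.val], by simp, by simpa using ⟨hA.mul_unit U, hlin⟩, by simp⟩
    · have hlt : S < linearRows B := by
        rw [← hS]
        refine ⟨linearRows_mul_subset A B, fun hsub => hA.2.1 ?_⟩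
        exact isUnit_of_linearRows_subset (C := 1) (by simpa using hfull) (by simpa using hlin)
          hsub
      obtain ⟨l, -, hl, rfl⟩ := ih _ hlt hfull.of_mul_left hB₂ hB rfl
      exact ⟨A :: l, by simp, by simpa using ⟨⟨hA, hA₂⟩, hl⟩, by simp⟩

end FreeAlgebra

end Matrix

/-- Linear matrix factorization over a finite field: a full, non-unit, right monic linear
matrix `L = A₀ + A₁x₁ + ⋯ + A_nx_n` factors as a product of linear matrix atoms. -/
theorem linear_matrix_factorization (F : Type*) [Field F] [Fintype F] (n d : ℕ)
    (A₀ : Matrix (Fin d) (Fin d) F) (A : Fin n → Matrix (Fin d) (Fin d) F)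
    (L : Matrix (Fin d) (Fin d) (FreeAlgebra F (Fin n)))
    (hL : ∀ i j, L i j = algebraMap F (FreeAlgebra F (Fin n)) (A₀ i j) +
      ∑ t : Fin n, A t i j • FreeAlgebra.ι F t)
    (hfull : Matrix.IsFullMat L) (hnonunit : ¬ IsUnit L)
    (hmonic : Matrix.rank (Matrix.of fun (i : Fin d) (p : Fin n × Fin d) => A p.1 i p.2) = d) :
    ∃ (r : ℕ) (_ : 1 ≤ r) (Fs : Fin r → Matrix (Fin d) (Fin d) (FreeAlgebra F (Fin n))),
      (∀ i, Matrix.IsLinearMat F (Fs i)) ∧ (∀ i, Matrix.IsAtomMat (Fs i)) ∧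
      L = (List.ofFn Fs).prod := by
  obtain ⟨l, hne, hl, hprod⟩ := hfull.exists_list_linear_atoms
    (fun i j => hL i j ▸ FreeAlgebra.linear_mem_degLT_two _ _) hnonunit
  refine ⟨l.length, List.length_pos_iff.2 hne, l.get, fun i => ?_,
    fun i => (hl _ (l.get_mem i)).1, by rw [List.ofFn_get, hprod]⟩
  exact ⟨_, _, fun a b => FreeAlgebra.eq_of_mem_degLT_two ((hl _ (l.get_mem i)).2 a b)⟩
end

section
/- (Factor Extraction Lemma.) Let F be a field, m, k ≥ 1 and ℓ = m + k. Suppose M ∈ F⟨X⟩^{m×m}, U ∈ F⟨X⟩^{m×k}, and V ∈ F⟨X⟩^{k×k} is a unit, and suppose the ℓ×ℓ block matrix [[M, U],[0, V]] equals P·C·D, where: C ∈ F⟨X⟩^{ℓ×ℓ} is a full linear matrix that is not a unit; P ∈ F⟨X⟩^{ℓ×ℓ} is upper triangular with all diagonal entries equal to 1; and D ∈ F⟨X⟩^{ℓ×ℓ} is a full non-unit matrix which is an atom. Then there exist matrices G, H ∈ F⟨X⟩^{m×m} such that M = G·H, G is a full non-unit, and H is an atom. -/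
open scoped Matrix

namespace FreeAlgebra

variable {F : Type*} [Field F] {n : ℕ}

/-- The coefficient of a word in a noncommutative polynomial, as a linear functional. -/
noncomputable def wordCoeff (w : FreeMonoid (Fin n)) : FreeAlgebra F (Fin n) →ₗ[F] F :=
  Finsupp.lapply w ∘ₗ (MonoidAlgebra.coeffLinearEquiv F).toLinearMap ∘ₗ
    (equivMonoidAlgebraFreeMonoid (R := F) (X := Fin n)).toLinearMap

lemma wordCoeff_apply (w : FreeMonoid (Fin n)) (x : FreeAlgebra F (Fin n)) :
    wordCoeff w x = (equivMonoidAlgebraFreeMonoid x).coeff w := rfl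

lemma ext_wordCoeff {x : FreeAlgebra F (Fin n)} (h : ∀ w, wordCoeff w x = 0) : x = 0 := by
  apply (equivMonoidAlgebraFreeMonoid (R := F) (X := Fin n)).injective
  ext w
  simpa [wordCoeff_apply] using h w

lemma finite_wordCoeff_ne_zero (x : FreeAlgebra F (Fin n)) : {w | wordCoeff w x ≠ 0}.Finite :=
  (equivMonoidAlgebraFreeMonoid x).coeff.hasFiniteSupport

lemma wordCoeff_ι_mul (t : Fin n) (w : FreeMonoid (Fin n)) (s : Fin n)
    (x : FreeAlgebra F (Fin n)) :
    wordCoeff (.of t * w) (ι F s * x) = if s = t then wordCoeff w x else 0 := by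
  have : equivMonoidAlgebraFreeMonoid (ι F s) = .single (FreeMonoid.of s) (1 : F) := by
    simp [equivMonoidAlgebraFreeMonoid]
  rw [wordCoeff_apply, map_mul equivMonoidAlgebraFreeMonoid, this]
  split_ifs with h
  · subst h
    rw [MonoidAlgebra.coeff_single_mul_eq_mul_coeff (m₂ := w), one_mul, wordCoeff_apply]
    simp
  · refine MonoidAlgebra.coeff_single_mul_of_forall_mul_ne _ _ fun d hd => ?_
    have := congrArg FreeMonoid.toList hd
    simp at this
    exact h this.1

lemma wordCoeff_of_mul_algebraMap (t : Fin n) (w : FreeMonoid (Fin n)) (a : F) :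
    wordCoeff (.of t * w) (algebraMap F (FreeAlgebra F (Fin n)) a) = 0 := by
  rw [wordCoeff_apply, AlgEquiv.commutes]
  simp

/-- A noncommutative polynomial of degree at most one. -/
def IsAffine (x : FreeAlgebra F (Fin n)) : Prop :=
  ∃ (a₀ : F) (a : Fin n → F), x = algebraMap F _ a₀ + ∑ t, a t • ι F t

lemma IsAffine.smul {x : FreeAlgebra F (Fin n)} (hx : IsAffine x) (c : F) : IsAffine (c • x) := by
  obtain ⟨a₀, a, rfl⟩ := hx
  exact ⟨c * a₀, c • a, by simp [Finset.smul_sum, mul_smul, Algebra.algebraMap_eq_smul_one]⟩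

lemma IsAffine.sum {κ : Type*} {s : Finset κ} {x : κ → FreeAlgebra F (Fin n)}
    (hx : ∀ j, IsAffine (x j)) : IsAffine (∑ j ∈ s, x j) := by
  choose a₀ a h using hx
  refine ⟨∑ j ∈ s, a₀ j, ∑ j ∈ s, a j, ?_⟩
  simp_rw [h, Finset.sum_add_distrib, map_sum, Finset.sum_apply, Finset.sum_smul]
  rw [Finset.sum_comm]

end FreeAlgebra

open FreeAlgebra
namespace Matrix

variable {F : Type*} [Field F] {n : ℕ}

/-- Comparing the coefficients of top degree in `L * B = 1` yields a nonzero scalar vector `b`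
for which `L * b` is a scalar vector. -/
lemma exists_scalar_mulVec {ι κ : Type*} [Fintype κ] [DecidableEq ι] [Nonempty ι]
    {L : Matrix ι κ (FreeAlgebra F (Fin n))} {B : Matrix κ ι (FreeAlgebra F (Fin n))}
    (hL : ∀ i j, IsAffine (L i j)) (h : L * B = 1) :
    ∃ (b : κ → F) (c : ι → F), b ≠ 0 ∧
      L *ᵥ (fun j => algebraMap F _ (b j)) = fun i => algebraMap F _ (c i) := by
  obtain ⟨i₀⟩ := ‹Nonempty ι›
  choose a₀ a ha using hL
  obtain ⟨w, ⟨j₀, hj₀⟩, hmax⟩ := Set.exists_max_image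
    {w : FreeMonoid (Fin n) | ∃ j, wordCoeff w (B j i₀) ≠ 0} FreeMonoid.length
    (by
      simp_rw [Set.ofPred_exists]
      exact Set.finite_iUnion fun j => finite_wordCoeff_ne_zero _)
    (by
      by_contra hne
      have hB : ∀ j, B j i₀ = 0 := fun j => ext_wordCoeff fun w => by
        by_contra hw
        exact hne ⟨w, j, hw⟩
      have := congrFun (congrFun h i₀) i₀
      simp [mul_apply, hB] at this)
  have hlong (t : Fin n) (j : κ) : wordCoeff (.of t * w) (B j i₀) = 0 := by
    by_contra hne
    have := hmax _ ⟨j, hne⟩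
    simp at this
  have hkill (t : Fin n) (i : ι) : ∑ j, a i j t * wordCoeff w (B j i₀) = 0 := by
    have h1 : wordCoeff (.of t * w) ((L * B) i i₀) = 0 := by
      rw [h, one_apply]
      split_ifs
      · simpa using wordCoeff_of_mul_algebraMap t w (1 : F)
      · simp
    rw [mul_apply, map_sum] at h1
    rw [← h1]
    refine Finset.sum_congr rfl fun j _ => ?_
    rw [ha, add_mul, map_add, ← Algebra.smul_def, map_smul, hlong, Finset.sum_mul, map_sum]
    simp [wordCoeff_ι_mul]
  refine ⟨fun j => wordCoeff w (B j i₀), fun i => ∑ j, a₀ i j * wordCoeff w (B j i₀),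
    fun h0 => hj₀ (congrFun h0 j₀), ?_⟩
  ext i
  simp_rw [mulVec, dotProduct, ha, add_mul, Finset.sum_add_distrib, map_sum, map_mul]
  rw [add_eq_left]
  simp_rw [← Algebra.commutes, ← Algebra.smul_def, Finset.smul_sum, smul_smul]
  rw [Finset.sum_comm]
  refine Finset.sum_eq_zero fun t _ => ?_
  rw [← Finset.sum_smul]
  simp_rw [mul_comm _ (a _ _ _), hkill, zero_smul]

/-- Every nonzero scalar vector is a column of an invertible scalar matrix. -/
lemma exists_inverse_col_eq {κ : Type*} [Fintype κ] [DecidableEq κ] {b : κ → F} {j : κ}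
    (hb : b j ≠ 0) : ∃ S S' : Matrix κ κ F, S * S' = 1 ∧ S' * S = 1 ∧ ∀ i, S i j = b i := by
  have hdet : (updateCol 1 j b).det = b j := by
    rw [← cramer_apply, cramer_one]; rfl
  have hu : IsUnit (updateCol 1 j b).det := by rw [hdet]; exact hb.isUnit
  exact ⟨updateCol 1 j b, (updateCol 1 j b)⁻¹, mul_nonsing_inv _ hu, nonsing_inv_mul _ hu, by simp⟩

section HasFreeKernel

variable {R : Type*} [Ring R] {ι κ : Type} [Fintype ι] [DecidableEq ι] [Fintype κ] [DecidableEq κ]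

/-- `L` has a right inverse `K` such that the idempotent `1 - K * L` factors through a free
module as `J * N` with `N * J = 1`; that is, `L` is a split surjection with free kernel. -/
def HasFreeKernel (L : Matrix ι κ R) : Prop :=
  ∃ (μ : Type) (_ : Fintype μ) (_ : DecidableEq μ) (K : Matrix κ ι R) (J : Matrix κ μ R)
    (N : Matrix μ κ R), L * K = 1 ∧ J * N = 1 - K * L ∧ N * J = 1

lemma hasFreeKernel_of_isEmpty [IsEmpty ι] (L : Matrix ι κ R) : HasFreeKernel L :=
  ⟨κ, inferInstance, inferInstance, 0, 1, 1, Subsingleton.elim _ _, by simp, by simp⟩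

lemma HasFreeKernel.of_mul_right {κ' : Type} [Fintype κ'] [DecidableEq κ'] {L : Matrix ι κ R}
    {S : Matrix κ κ' R} {S' : Matrix κ' κ R} (h : S * S' = 1) (h' : S' * S = 1)
    (hL : HasFreeKernel (L * S)) : HasFreeKernel L := by
  obtain ⟨μ, _, _, K, J, N, h1, h2, h3⟩ := hL
  refine ⟨μ, inferInstance, inferInstance, S * K, S * J, N * S', ?_, ?_, ?_⟩
  · rw [← Matrix.mul_assoc, h1]
  · rw [show S * J * (N * S') = S * (J * N) * S' by simp only [Matrix.mul_assoc], h2]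
    rw [Matrix.mul_sub, Matrix.sub_mul, Matrix.mul_one, h]
    simp only [Matrix.mul_assoc, h, Matrix.mul_one]
  · rw [show N * S' * (S * J) = N * (S' * S) * J by simp only [Matrix.mul_assoc], h',
      Matrix.mul_one, h3]

lemma HasFreeKernel.of_mul_left {ι' : Type} [Fintype ι'] [DecidableEq ι'] {L : Matrix ι κ R}
    {T : Matrix ι' ι R} {T' : Matrix ι ι' R} (h' : T' * T = 1)
    (hL : HasFreeKernel (T * L)) : HasFreeKernel L := by
  obtain ⟨μ, _, _, K, J, N, h1, h2, h3⟩ := hL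
  refine ⟨μ, inferInstance, inferInstance, K * T, J, N, ?_, ?_, h3⟩
  · calc L * (K * T) = (T' * T) * L * (K * T) := by rw [h', Matrix.one_mul]
      _ = T' * (T * L * K) * T := by simp only [Matrix.mul_assoc]
      _ = 1 := by rw [h1, Matrix.mul_one, h']
  · rw [h2, Matrix.mul_assoc]

lemma HasFreeKernel.of_submatrix {ι' κ' : Type} [Fintype ι'] [DecidableEq ι'] [Fintype κ']
    [DecidableEq κ'] {L : Matrix ι κ R} (e : ι' ≃ ι) (f : κ' ≃ κ)
    (hL : HasFreeKernel (L.submatrix e f)) : HasFreeKernel L := by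
  obtain ⟨μ, _, _, K, J, N, h1, h2, h3⟩ := hL
  refine ⟨μ, inferInstance, inferInstance, K.submatrix f.symm e.symm, J.submatrix f.symm id,
    N.submatrix id f.symm, ?_, ?_, ?_⟩
  · have := congrArg (fun A => A.submatrix e.symm e.symm) h1
    simpa [← submatrix_mul_equiv _ _ _ f.symm] using this
  · have := congrArg (fun A => A.submatrix f.symm f.symm) h2
    simpa [submatrix_sub, ← submatrix_mul_equiv _ _ _ e.symm,
      ← submatrix_mul_equiv _ _ _ (Equiv.refl μ)] using this
  · rw [submatrix_mul_equiv, h3, submatrix_id_id]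

lemma HasFreeKernel.fromCols_zero {L : Matrix ι κ R} (hL : HasFreeKernel L) :
    HasFreeKernel (fromCols (0 : Matrix ι Unit R) L) := by
  obtain ⟨μ, _, _, K, J, N, h1, h2, h3⟩ := hL
  refine ⟨Unit ⊕ μ, inferInstance, inferInstance, fromRows 0 K, fromBlocks 1 0 0 J,
    fromBlocks 1 0 0 N, ?_, ?_, ?_⟩
  · simp [fromCols_mul_fromRows, h1]
  · ext (_ | _) (_ | _) <;> simp [fromBlocks_multiply, h2, one_apply]
  · simp [fromBlocks_multiply, h3]

lemma HasFreeKernel.fromBlocks_one {L : Matrix ι κ R} (hL : HasFreeKernel L)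
    (X : Matrix Unit κ R) :
    HasFreeKernel (fromBlocks (1 : Matrix Unit Unit R) X 0 L) := by
  obtain ⟨μ, _, _, K, J, N, h1, h2, h3⟩ := hL
  refine ⟨μ, inferInstance, inferInstance, fromBlocks 1 (-(X * K)) 0 K, fromRows (-(X * J)) J,
    fromCols 0 N, ?_, ?_, ?_⟩
  · simp [fromBlocks_multiply, h1]
  · ext (_ | _) (_ | _) <;>
      simp [fromBlocks_multiply, Matrix.mul_assoc, h2, one_apply, Matrix.mul_add,
        sub_eq_add_neg, add_comm]
  · simp [fromCols_mul_fromRows, h3]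

end HasFreeKernel

lemma exists_equiv_unit_sum {κ : Type} [DecidableEq κ] (j : κ) :
    ∃ e : Unit ⊕ {i // i ≠ j} ≃ κ, e (.inl ()) = j :=
  ⟨(Equiv.sumComm _ _).trans
    ((Equiv.optionEquivSumPUnit _).symm.trans (Equiv.optionSubtypeNe j)), by simp⟩

lemma isAffine_mul_map {ι κ κ' : Type*} [Fintype κ] {L : Matrix ι κ (FreeAlgebra F (Fin n))}
    (hL : ∀ i j, IsAffine (L i j)) (S : Matrix κ κ' F) (i : ι) (j : κ') :
    IsAffine ((L * S.map (algebraMap F (FreeAlgebra F (Fin n)))) i j) := by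
  simp_rw [mul_apply, map_apply, ← Algebra.commutes, ← Algebra.smul_def]
  exact .sum fun _ => (hL _ _).smul _

lemma isAffine_map_mul {ι κ κ' : Type*} [Fintype κ] {L : Matrix κ ι (FreeAlgebra F (Fin n))}
    (hL : ∀ i j, IsAffine (L i j)) (S : Matrix κ' κ F) (i : κ') (j : ι) :
    IsAffine ((S.map (algebraMap F (FreeAlgebra F (Fin n))) * L) i j) := by
  simp_rw [mul_apply, map_apply, ← Algebra.smul_def]
  exact .sum fun _ => (hL _ _).smul _

/-- A right invertible linear matrix over a free algebra has free kernel. -/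
theorem hasFreeKernel_of_isAffine {ι κ : Type} [Fintype ι] [DecidableEq ι] [Fintype κ]
    [DecidableEq κ] {L : Matrix ι κ (FreeAlgebra F (Fin n))} (hL : ∀ i j, IsAffine (L i j))
    {B : Matrix κ ι (FreeAlgebra F (Fin n))} (h : L * B = 1) : HasFreeKernel L := by
  induction hp : Fintype.card κ generalizing ι κ with
  | zero =>
    have := Fintype.card_eq_zero_iff.1 hp
    rcases isEmpty_or_nonempty ι with _ | ⟨⟨i⟩⟩
    · exact hasFreeKernel_of_isEmpty L
    · have := congrFun (congrFun h i) i
      simp [mul_apply] at this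
  | succ p ih =>
    rcases isEmpty_or_nonempty ι with _ | hne
    · exact hasFreeKernel_of_isEmpty L
    obtain ⟨b, c, hb, hbc⟩ := exists_scalar_mulVec hL h
    obtain ⟨j, hj⟩ := Function.ne_iff.1 hb
    obtain ⟨S, S', hS, hS', hSb⟩ := exists_inverse_col_eq hj
    obtain ⟨e, he⟩ := exists_equiv_unit_sum j
    let f := algebraMap F (FreeAlgebra F (Fin n))
    have hSf : S.map f * S'.map f = 1 := by rw [← Matrix.map_mul, hS]; simp
    have hSf' : S'.map f * S.map f = 1 := by rw [← Matrix.map_mul, hS']; simp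
    refine HasFreeKernel.of_mul_right hSf hSf' ?_
    have hcard : Fintype.card {i // i ≠ j} = p := by
      simp [hp]
    have hcol (i : ι) : (L * S.map f) i j = f (c i) := by
      rw [← congrFun hbc i]
      simp [mul_apply, mulVec, dotProduct, hSb, f]
    have hinv : (L * S.map f) * (S'.map f * B) = 1 := by
      rw [show L * S.map f * (S'.map f * B) = L * (S.map f * S'.map f) * B by
        simp only [Matrix.mul_assoc], hSf, Matrix.mul_one, h]
    have haff := isAffine_mul_map hL S
    by_cases hc : c = 0
    · refine HasFreeKernel.of_submatrix (Equiv.refl ι) e ?_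
      have hdec : (L * S.map f).submatrix (Equiv.refl ι) e
          = fromCols 0 ((L * S.map f).submatrix id (e ∘ Sum.inr)) := by
        ext i (u | u)
        · simp [he, hcol, hc]
        · simp
      have hmul := submatrix_mul_equiv (L * S.map f) (S'.map f * B) (Equiv.refl ι) e (Equiv.refl ι)
      rw [hinv, submatrix_one_equiv, hdec, ← fromRows_toRows (submatrix (S'.map f * B) _ _),
        fromCols_mul_fromRows, Matrix.zero_mul, zero_add] at hmul
      rw [hdec]
      exact HasFreeKernel.fromCols_zero (ih (fun i k => haff _ _) hmul hcard)
    · obtain ⟨i, hi⟩ := Function.ne_iff.1 hc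
      obtain ⟨T, T', hT, hT', hTc⟩ := exists_inverse_col_eq hi
      obtain ⟨e', he'⟩ := exists_equiv_unit_sum i
      have hTf : T.map f * T'.map f = 1 := by rw [← Matrix.map_mul, hT]; simp
      refine HasFreeKernel.of_mul_left hTf (HasFreeKernel.of_submatrix e' e ?_)
      have haff' := isAffine_map_mul haff T'
      have hinv' : (T'.map f * (L * S.map f)) * (S'.map f * B * T.map f) = 1 := by
        calc _ = T'.map f * (L * S.map f * (S'.map f * B)) * T.map f := by
              simp only [Matrix.mul_assoc]
          _ = 1 := by rw [hinv, Matrix.mul_one, ← Matrix.map_mul, hT']; simp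
      have hcol' (k : ι) : (T'.map f * (L * S.map f)) k j = if k = i then 1 else 0 := by
        have := congrFun (congrFun hT' k) i
        rw [one_apply, mul_apply] at this
        rw [mul_apply]
        simp_rw [hcol, map_apply, f, ← map_mul, ← map_sum, ← hTc, this]
        split_ifs <;> simp
      generalize T'.map f * (L * S.map f) = A at haff' hinv' hcol' ⊢
      generalize S'.map f * B * T.map f = B' at hinv'
      have hdec : A.submatrix e' e = fromBlocks 1 (A.submatrix (e' ∘ Sum.inl) (e ∘ Sum.inr)) 0
          (A.submatrix (e' ∘ Sum.inr) (e ∘ Sum.inr)) := by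
        have hne (u : {k // k ≠ i}) : e' (.inr u) ≠ i := fun hu => by
          simpa using e'.injective (hu.trans he'.symm)
        ext (_ | _) (_ | _) <;> simp [he, he', hcol', hne]
      have hmul := submatrix_mul_equiv A B' e' e e'
      rw [hinv', submatrix_one_equiv, hdec, ← fromBlocks_toBlocks (submatrix B' _ _),
        fromBlocks_multiply, ← Matrix.fromBlocks_one, fromBlocks_inj] at hmul
      have hmul' := hmul.2.2.2
      rw [Matrix.zero_mul, zero_add] at hmul'
      rw [hdec]
      exact HasFreeKernel.fromBlocks_one (ih (fun _ _ => haff' _ _) hmul' hcard) _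


section Blocks

variable {R : Type*} [Ring R]

/-- An upper triangular matrix with unit diagonal entries equal to one is invertible. -/
lemma isUnit_of_unitriangular {d : ℕ} {P : Matrix (Fin d) (Fin d) R}
    (hP : ∀ i j, j < i → P i j = 0) (hdiag : ∀ i, P i i = 1) : IsUnit P := by
  have hpow (r : ℕ) (i j : Fin d) (hij : (j : ℕ) < i + r) : ((1 - P) ^ r) i j = 0 := by
    induction r generalizing i with
    | zero => rw [pow_zero, one_apply_ne (by rintro rfl; simp at hij)]
    | succ r ih =>
      rw [pow_succ', mul_apply]
      refine Finset.sum_eq_zero fun k _ => ?_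
      rcases lt_trichotomy k i with hk | rfl | hk
      · simp [hP _ _ hk, one_apply_ne hk.ne']
      · simp [hdiag]
      · rw [ih k (by have : (i : ℕ) < k := hk
                     omega), mul_zero]
  have hnil : IsNilpotent (1 - P) := ⟨d, by ext i j; exact hpow d i j (by omega)⟩
  simpa using hnil.isUnit_one_sub

lemma IsFullMat.of_unit_mul {d : ℕ} {A Q : Matrix (Fin d) (Fin d) R} (hA : IsFullMat A)
    (hQ : IsUnit Q) : IsFullMat (Q * A) := by
  obtain ⟨u, rfl⟩ := hQ
  rintro ⟨r, hr, X, Y, h⟩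
  exact hA ⟨r, hr, u⁻¹.1 * X, Y, by
    rw [Matrix.mul_assoc, ← h, ← Matrix.mul_assoc, u.inv_mul, Matrix.one_mul]⟩

lemma IsFullMat.mul_unit {d : ℕ} {A Q : Matrix (Fin d) (Fin d) R} (hA : IsFullMat A)
    (hQ : IsUnit Q) : IsFullMat (A * Q) := by
  obtain ⟨u, rfl⟩ := hQ
  rintro ⟨r, hr, X, Y, h⟩
  exact hA ⟨r, hr, X, Y * u⁻¹.1, by
    rw [← Matrix.mul_assoc, ← h, Matrix.mul_assoc, u.mul_inv, Matrix.mul_one]⟩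

lemma IsAtomMat.of_unit_mul {d : ℕ} {A Q : Matrix (Fin d) (Fin d) R} (hA : IsAtomMat A)
    (hQ : IsUnit Q) : IsAtomMat (Q * A) := by
  refine ⟨hA.1.of_unit_mul hQ, ?_, fun X Y h => ?_⟩
  · obtain ⟨u, rfl⟩ := hQ
    simpa using hA.2.1
  · obtain ⟨u, rfl⟩ := hQ
    have := hA.2.2 (u⁻¹.1 * X) Y (by
      rw [Matrix.mul_assoc, ← h, ← Matrix.mul_assoc, u.inv_mul, Matrix.one_mul])
    simpa using this

variable {m k : ℕ}

/-- A block upper triangular matrix, reindexed by `Fin (m + k)`. -/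
def finBlockTriangular (G : Matrix (Fin m) (Fin m) R) (Z : Matrix (Fin m) (Fin k) R)
    (W : Matrix (Fin k) (Fin k) R) : Matrix (Fin (m + k)) (Fin (m + k)) R :=
  (fromBlocks G Z 0 W).submatrix finSumFinEquiv.symm finSumFinEquiv.symm

variable {G : Matrix (Fin m) (Fin m) R} {Z : Matrix (Fin m) (Fin k) R}
  {W : Matrix (Fin k) (Fin k) R}

lemma isUnit_finBlockTriangular_iff :
    IsUnit (finBlockTriangular G Z W) ↔ IsUnit (fromBlocks G Z 0 W) :=
  isUnit_map_iff (reindexRingEquiv R finSumFinEquiv) (fromBlocks G Z 0 W)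

lemma finBlockTriangular_mul_eq {r : ℕ} (X : Matrix (Fin m) (Fin r) R)
    (Y : Matrix (Fin r) (Fin m) R) :
    finBlockTriangular (X * Y) Z W =
      (fromBlocks X Z 0 W).submatrix finSumFinEquiv.symm finSumFinEquiv.symm *
        (fromBlocks Y 0 0 (1 : Matrix (Fin k) (Fin k) R)).submatrix finSumFinEquiv.symm
          finSumFinEquiv.symm := by
  rw [submatrix_mul_equiv, fromBlocks_multiply]
  simp [finBlockTriangular]

lemma isUnit_fromBlocks (hG : IsUnit G) (hW : IsUnit W) : IsUnit (fromBlocks G Z 0 W) := by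
  obtain ⟨g, rfl⟩ := hG
  obtain ⟨w, rfl⟩ := hW
  refine isUnit_iff_exists.2 ⟨fromBlocks g⁻¹.1 (-(g⁻¹.1 * Z * w⁻¹.1)) 0 w⁻¹.1, ?_, ?_⟩ <;>
    simp [fromBlocks_multiply, ← Matrix.mul_assoc, ← fromBlocks_one]
  simp [Matrix.mul_assoc]

lemma isUnit_of_isUnit_fromBlocks (h : IsUnit (fromBlocks G Z 0 W)) (hW : IsUnit W) :
    IsUnit G := by
  obtain ⟨E, h1, h2⟩ := isUnit_iff_exists.1 h
  obtain ⟨w, rfl⟩ := hW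
  rw [← fromBlocks_toBlocks E, fromBlocks_multiply, ← fromBlocks_one, fromBlocks_inj] at h1 h2
  have h21 : E.toBlocks₂₁ = 0 := by
    have := h1.2.2.1
    rw [Matrix.zero_mul, zero_add] at this
    rw [← Matrix.one_mul E.toBlocks₂₁, ← w.inv_mul, Matrix.mul_assoc, this, Matrix.mul_zero]
  refine isUnit_iff_exists.2 ⟨E.toBlocks₁₁, by simpa [h21] using h1.1, by simpa using h2.1⟩

lemma IsFullMat.of_finBlockTriangular (h : IsFullMat (finBlockTriangular G Z W)) :
    IsFullMat G := by
  rintro ⟨r, hr, X, Y, rfl⟩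
  exact h ⟨r + k, by omega, _, _, finBlockTriangular_mul_eq X Y⟩

lemma IsAtomMat.of_finBlockTriangular (h : IsAtomMat (finBlockTriangular G Z W))
    (hW : IsUnit W) : IsAtomMat G := by
  refine ⟨h.1.of_finBlockTriangular, fun hG => h.2.1 ?_, ?_⟩
  · exact isUnit_finBlockTriangular_iff.2 (isUnit_fromBlocks hG hW)
  · rintro X Y rfl
    refine (h.2.2 _ _ (finBlockTriangular_mul_eq X Y)).imp (fun hX => ?_) fun hY => ?_
    · exact isUnit_of_isUnit_fromBlocks (isUnit_finBlockTriangular_iff.1 hX) hW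
    · exact isUnit_of_isUnit_fromBlocks (isUnit_finBlockTriangular_iff.1 hY) isUnit_one

end Blocks

/-- A right invertible linear matrix over a free algebra is, in adapted coordinates, a
coordinate projection. -/
lemma exists_complement {m k : ℕ}
    {L : Matrix (Fin k) (Fin (m + k)) (FreeAlgebra F (Fin n))}
    (hL : ∀ i j, IsAffine (L i j)) {B : Matrix (Fin (m + k)) (Fin k) (FreeAlgebra F (Fin n))}
    (h : L * B = 1) :
    ∃ (K : Matrix (Fin (m + k)) (Fin k) (FreeAlgebra F (Fin n)))
      (J : Matrix (Fin (m + k)) (Fin m) (FreeAlgebra F (Fin n)))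
      (N : Matrix (Fin m) (Fin (m + k)) (FreeAlgebra F (Fin n))),
      fromRows N L * fromCols J K = 1 ∧ fromCols J K * fromRows N L = 1 := by
  obtain ⟨μ, _, _, K, J, N, h1, h2, h3⟩ := hasFreeKernel_of_isAffine hL h
  have hNK : N * K = 0 := by
    calc N * K = N * (J * N) * K := by
          rw [← Matrix.mul_assoc N, h3, Matrix.one_mul]
      _ = 0 := by
          rw [h2, Matrix.mul_sub, Matrix.sub_mul, Matrix.mul_one,
            show N * (K * L) * K = N * K * (L * K) by simp only [Matrix.mul_assoc], h1,
            Matrix.mul_one, sub_self]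
  have hLJ : L * J = 0 := by
    calc L * J = L * (J * N) * J := by
          rw [Matrix.mul_assoc, Matrix.mul_assoc, h3, Matrix.mul_one]
      _ = 0 := by
          rw [h2, Matrix.mul_sub, Matrix.sub_mul, Matrix.mul_one, ← Matrix.mul_assoc L, h1,
            Matrix.one_mul, sub_self]
  have hNJ : fromRows N L * fromCols J K = 1 := by
    rw [fromRows_mul_fromCols, h1, h3, hNK, hLJ, Matrix.fromBlocks_one]
  have hJN : fromCols J K * fromRows N L = 1 := by
    rw [fromCols_mul_fromRows, h2, sub_add_cancel]
  have hcard : Fintype.card μ = m := by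
    let φ : FreeAlgebra F (Fin n) →+* F := (FreeAlgebra.algebraMapInv).toRingHom
    have := square_of_invertible ((fromRows N L).map φ) ((fromCols J K).map φ)
      (by rw [← Matrix.map_mul, hNJ]; simp) (by rw [← Matrix.map_mul, hJN]; simp)
    simpa using this
  let e : Fin m ≃ μ := (Fintype.equivFinOfCardEq hcard).symm
  refine ⟨K, J.submatrix id e, N.submatrix e id, ?_, ?_⟩
  · rw [fromRows_mul_fromCols, ← Matrix.fromBlocks_one, fromBlocks_inj]
    refine ⟨?_, ?_, ?_, h1⟩
    · rw [← submatrix_mul _ _ _ id _ Function.bijective_id, h3, submatrix_one_equiv]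
    · exact congrArg (fun A => A.submatrix e id) hNK
    · exact congrArg (fun A => A.submatrix id e) hLJ
  · rw [fromCols_mul_fromRows, submatrix_mul_equiv, h2]
    simp

end Matrix

open Matrix

/-- Factor Extraction Lemma: if the block matrix `[[M, U], [0, V]]` (with `V` a unit) equals
`P·C·D` with `C` a full non-unit linear matrix, `P` upper triangular with all-ones diagonal,
and `D` a full non-unit atom, then `M = G·H` with `G` a full non-unit and `H` an atom. -/
theorem factor_extraction (F : Type*) [Field F] (n m k : ℕ) (hm : 1 ≤ m) (hk : 1 ≤ k)
    (M : Matrix (Fin m) (Fin m) (FreeAlgebra F (Fin n)))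
    (U : Matrix (Fin m) (Fin k) (FreeAlgebra F (Fin n)))
    (V : Matrix (Fin k) (Fin k) (FreeAlgebra F (Fin n))) (hV : IsUnit V)
    (P C D : Matrix (Fin (m + k)) (Fin (m + k)) (FreeAlgebra F (Fin n)))
    (hC : Matrix.IsLinearMat F C) (hCfull : Matrix.IsFullMat C) (hCnonunit : ¬ IsUnit C)
    (hP : ∀ i j : Fin (m + k), j < i → P i j = 0) (hPdiag : ∀ i : Fin (m + k), P i i = 1)
    (hD : Matrix.IsAtomMat D)
    (heq : Matrix.reindex finSumFinEquiv finSumFinEquiv (Matrix.fromBlocks M U 0 V)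
      = P * C * D) :
    ∃ G H : Matrix (Fin m) (Fin m) (FreeAlgebra F (Fin n)),
      M = G * H ∧ Matrix.IsFullMat G ∧ ¬ IsUnit G ∧ Matrix.IsAtomMat H := by
  set A := P * C with hA
  let e : Fin m ⊕ Fin k ≃ Fin (m + k) := finSumFinEquiv
  have hPunit : IsUnit P := isUnit_of_unitriangular hP hPdiag
  have hAfull : IsFullMat A := hCfull.of_unit_mul hPunit
  have hAnonunit : ¬ IsUnit A := by
    obtain ⟨u, rfl⟩ := hPunit
    simpa [hA] using hCnonunit
  let W : Matrix (Fin k) (Fin k) (FreeAlgebra F (Fin n)) :=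
    P.submatrix (Fin.natAdd m) (Fin.natAdd m)
  have hW : IsUnit W := isUnit_of_unitriangular (fun i j hij => hP _ _ (by simpa using hij))
    fun i => hPdiag _
  let L := C.submatrix (Fin.natAdd m) id
  let A₁ := A.submatrix (Fin.castAdd k) id
  let D₁ := D.submatrix id (Fin.castAdd k)
  let D₂ := D.submatrix id (Fin.natAdd m)
  have hlow (i : Fin k) (j : Fin m) : P (Fin.natAdd m i) (Fin.castAdd k j) = 0 :=
    hP _ _ (by rw [Fin.lt_def]; simp; omega)
  have hA₂ : A.submatrix (Fin.natAdd m) id = W * L := by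
    ext i j
    simp [hA, mul_apply, W, L, Fin.sum_univ_add, hlow]
  have hArows : A.submatrix e id = fromRows A₁ (W * L) := by
    rw [← hA₂]
    ext (i | i) j <;> simp [e, A₁]
  have hDcols : D.submatrix id e = fromCols D₁ D₂ := by
    ext i (j | j) <;> simp [e, D₁, D₂]
  have hblocks : fromBlocks M U 0 V = fromRows A₁ (W * L) * fromCols D₁ D₂ := by
    have := congrArg (fun A => A.submatrix e e) heq
    rw [← hArows, ← hDcols]
    simpa [e, submatrix_mul _ _ _ id _ Function.bijective_id] using this
  rw [fromRows_mul_fromCols, fromBlocks_inj] at hblocks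
  obtain ⟨hM, -, h0, hV'⟩ := hblocks
  obtain ⟨w, hw⟩ := hW
  have hLD₁ : L * D₁ = 0 := by
    rw [← Matrix.one_mul L, ← w.inv_mul, Matrix.mul_assoc _ _ L, Matrix.mul_assoc, hw, ← h0,
      Matrix.mul_zero]
  have hLD₂ : L * D₂ = w⁻¹.1 * V := by
    rw [← Matrix.one_mul L, ← w.inv_mul, Matrix.mul_assoc _ _ L, Matrix.mul_assoc, hw, ← hV']
  have hLD₂unit : IsUnit (L * D₂) := by
    rw [hLD₂]
    exact w⁻¹.isUnit.mul hV
  obtain ⟨v, hv⟩ := hLD₂unit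
  have hLinv : L * (D₂ * v⁻¹.1) = 1 := by
    rw [← Matrix.mul_assoc, ← hv, v.mul_inv]
  have hLaff (i j) : IsAffine (L i j) := by
    obtain ⟨C₀, C₁, h⟩ := hC
    exact ⟨_, fun t => C₁ t _ _, h _ _⟩
  obtain ⟨K, J, N, hNJ, hJN⟩ := exists_complement hLaff hLinv
  let Q := (fromCols J K).submatrix id e.symm
  let Q' := (fromRows N L).submatrix e.symm id
  have hQQ' : Q * Q' = 1 := by
    rw [submatrix_mul_equiv, hJN, submatrix_id_id]
  have hQ'Q : Q' * Q = 1 := by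
    rw [← submatrix_mul _ _ _ id _ Function.bijective_id, hNJ, submatrix_one_equiv]
  have hQ : IsUnit Q := isUnit_iff_exists.2 ⟨Q', hQQ', hQ'Q⟩
  have hQ' : IsUnit Q' := isUnit_iff_exists.2 ⟨Q, hQ'Q, hQQ'⟩
  have hLJK := hNJ
  rw [fromRows_mul_fromCols, ← Matrix.fromBlocks_one, fromBlocks_inj] at hLJK
  obtain ⟨-, -, hLJ, hLK⟩ := hLJK
  rw [fromCols_mul_fromRows] at hJN
  have hAQ : A * Q = finBlockTriangular (A₁ * J) (A₁ * K) W := by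
    have : A = (fromRows A₁ (W * L)).submatrix e.symm id := by rw [← hArows]; simp
    rw [this, ← submatrix_mul _ _ _ id _ Function.bijective_id, fromRows_mul_fromCols]
    simp [Matrix.mul_assoc, hLJ, hLK, finBlockTriangular, e]
  have hQD : Q' * D = finBlockTriangular (N * D₁) (N * D₂) (L * D₂) := by
    have : D = (fromCols D₁ D₂).submatrix id e.symm := by rw [← hDcols]; simp
    rw [this, ← submatrix_mul _ _ _ id _ Function.bijective_id, fromRows_mul_fromCols, hLD₁]
    simp [finBlockTriangular, e]
  refine ⟨A₁ * J, N * D₁, ?_, ?_, fun hG => ?_, ?_⟩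
  · calc M = A₁ * ((J * N + K * L) * D₁) := by rw [hJN, Matrix.one_mul, hM]
      _ = _ := by
        rw [Matrix.add_mul, Matrix.mul_assoc K, hLD₁, Matrix.mul_zero, add_zero]
        simp only [Matrix.mul_assoc]
  · exact (hAQ ▸ hAfull.mul_unit hQ).of_finBlockTriangular
  · have hAQunit : IsUnit (A * Q) := by
      rw [hAQ]
      exact isUnit_finBlockTriangular_iff.2 (isUnit_fromBlocks hG ⟨w, hw⟩)
    obtain ⟨q, hq⟩ := hQ
    rw [← hq] at hAQunit
    exact hAnonunit (by simpa using hAQunit)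
  · exact (hQD ▸ hD.of_unit_mul hQ').of_finBlockTriangular ⟨v, hv⟩
end

section
/- Let F⟨X⟩^{ℓ×ℓ} be the matrix ring over the free algebra and suppose D ∈ F⟨X⟩^{ℓ×ℓ} is an atom which has the block upper-triangular form D = [[d₁, d₃],[0, d₄]], where d₁ ∈ F⟨X⟩^{m×m}, d₄ ∈ F⟨X⟩^{k×k} with ℓ = m + k, and d₄ is a unit of F⟨X⟩^{k×k}. Then d₁ is an atom of F⟨X⟩^{m×m}. -/
/-- Over a possibly noncommutative ring, a block upper-triangular matrix whose bottom-right block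
is a unit is itself a unit if and only if its top-left block is. -/
theorem Matrix.isUnit_fromBlocks_zero₂₁_iff_of_isUnit {R m k : Type*} [Ring R] [Fintype m]
    [Fintype k] [DecidableEq m] [DecidableEq k] (A : Matrix m m R) (B : Matrix m k R)
    {D : Matrix k k R} (hD : IsUnit D) :
    IsUnit (Matrix.fromBlocks A B 0 D) ↔ IsUnit A := by
  obtain ⟨E, hDE, hED⟩ := isUnit_iff_exists.mp hD
  simp only [isUnit_iff_exists]
  constructor
  · rintro ⟨N, hMN, hNM⟩
    rw [← Matrix.fromBlocks_toBlocks N, Matrix.fromBlocks_multiply, ← Matrix.fromBlocks_one,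
      Matrix.fromBlocks_inj] at hMN hNM
    have hN : N.toBlocks₂₁ = 0 := by
      have h : D * N.toBlocks₂₁ = 0 := by simpa using hMN.2.2.1
      rw [← Matrix.one_mul N.toBlocks₂₁, ← hED, Matrix.mul_assoc, h, Matrix.mul_zero]
    exact ⟨N.toBlocks₁₁, by simpa [hN] using hMN.1, by simpa using hNM.1⟩
  · rintro ⟨C, hAC, hCA⟩
    refine ⟨Matrix.fromBlocks C (-(C * B * E)) 0 E, ?_, ?_⟩
    · rw [Matrix.fromBlocks_multiply, ← Matrix.fromBlocks_one, Matrix.fromBlocks_inj]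
      simp [hAC, hDE, ← Matrix.mul_assoc]
    · rw [Matrix.fromBlocks_multiply, ← Matrix.fromBlocks_one, Matrix.fromBlocks_inj]
      simp [hCA, hED, Matrix.mul_assoc]

/-- Reindexing both sides of a square matrix along the same equivalence preserves and reflects
units. -/
theorem Matrix.isUnit_reindex_iff {R m n : Type*} [Ring R] [Fintype m] [Fintype n]
    [DecidableEq m] [DecidableEq n] (e : m ≃ n) (M : Matrix m m R) :
    IsUnit (Matrix.reindex e e M) ↔ IsUnit M :=
  MulEquiv.isUnit_map (Matrix.reindexRingEquiv R e)

/-- A factorization of the top-left block of a block upper-triangular matrix extends to a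
factorization of the whole matrix. -/
theorem Matrix.reindex_fromBlocks_mul {R : Type*} [Ring R] {m r k : ℕ}
    (A : Matrix (Fin m) (Fin r) R) (B : Matrix (Fin r) (Fin m) R)
    (C : Matrix (Fin m) (Fin k) R) (D : Matrix (Fin k) (Fin k) R) :
    Matrix.reindex finSumFinEquiv finSumFinEquiv (Matrix.fromBlocks (A * B) C 0 D) =
      Matrix.reindex finSumFinEquiv finSumFinEquiv (Matrix.fromBlocks A C 0 D) *
        Matrix.reindex finSumFinEquiv finSumFinEquiv
          (Matrix.fromBlocks B 0 0 (1 : Matrix (Fin k) (Fin k) R)) := by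
  simp only [Matrix.reindex_apply, Matrix.submatrix_mul_equiv, Matrix.fromBlocks_multiply]
  simp

/-- If an atom `D` of `F⟨X⟩^{ℓ×ℓ}` has block upper-triangular form `[[d₁, d₃], [0, d₄]]` with
`d₄` a unit, then the top-left block `d₁` is an atom. -/
theorem atom_block_triangular (F : Type*) [Field F] (n m k : ℕ)
    (d₁ : Matrix (Fin m) (Fin m) (FreeAlgebra F (Fin n)))
    (d₃ : Matrix (Fin m) (Fin k) (FreeAlgebra F (Fin n)))
    (d₄ : Matrix (Fin k) (Fin k) (FreeAlgebra F (Fin n))) (hd₄ : IsUnit d₄)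
    (hatom : Matrix.IsAtomMat
      (Matrix.reindex finSumFinEquiv finSumFinEquiv (Matrix.fromBlocks d₁ d₃ 0 d₄))) :
    Matrix.IsAtomMat d₁ := by
  obtain ⟨hfull, hunit, hfac⟩ := hatom
  refine ⟨?_, ?_, ?_⟩
  · rintro ⟨r, hr, A, B, rfl⟩
    exact hfull ⟨r + k, by omega, _, _, Matrix.reindex_fromBlocks_mul A B d₃ d₄⟩
  · rwa [Matrix.isUnit_reindex_iff,
      Matrix.isUnit_fromBlocks_zero₂₁_iff_of_isUnit _ _ hd₄] at hunit
  · rintro A B rfl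
    have h := hfac _ _ (Matrix.reindex_fromBlocks_mul A B d₃ d₄)
    rwa [Matrix.isUnit_reindex_iff, Matrix.isUnit_reindex_iff,
      Matrix.isUnit_fromBlocks_zero₂₁_iff_of_isUnit _ _ hd₄,
      Matrix.isUnit_fromBlocks_zero₂₁_iff_of_isUnit _ _ isUnit_one] at h
end

section
/- Let D ∈ ℚ[x]^{d×r} be a linear matrix in T-normal form and let U ∈ ℚ[x]^{r×s} be a matrix with D·U = 0. Then there exists a matrix N ∈ ℚ[x]^{r×r} whose determinant is a nonzero rational constant (so N is a unit of the matrix ring with N⁻¹ ∈ ℚ[x]^{r×r}) such that for every index i ∈ {1,…,r}, either the i-th column of D·N is zero or the i-th row of N⁻¹·U is zero. -/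
open Polynomial

/-- A linear matrix `D` over `ℚ[x]` (entries of degree ≤ 1, `D = D' + D''x`) is in
*T-normal form* if its columns are partitioned into three sets: zero columns (`J₁`),
scalar columns (`J₂`, i.e. the `x`-coefficient part vanishes), and the remaining
columns (`J₃`), such that the scalar matrix whose columns are the constant parts of the
`J₂`-columns together with the `x`-coefficient parts of the `J₃`-columns has full
column rank, i.e. these columns are linearly independent over `ℚ`. -/
def Matrix.IsTNormal {d r : ℕ} (D : Matrix (Fin d) (Fin r) ℚ[X]) : Prop :=
  ∃ J₁ J₂ J₃ : Finset (Fin r),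
    (∀ j : Fin r, j ∈ J₁ ∨ j ∈ J₂ ∨ j ∈ J₃) ∧
    Disjoint J₁ J₂ ∧ Disjoint J₁ J₃ ∧ Disjoint J₂ J₃ ∧
    (∀ j ∈ J₁, ∀ i, D i j = 0) ∧
    (∀ j ∈ J₂, ∀ i, (D i j).coeff 1 = 0) ∧
    LinearIndependent ℚ (Sum.elim
      (fun j : {j // j ∈ J₂} => fun i : Fin d => (D i j.val).coeff 0)
      (fun j : {j // j ∈ J₃} => fun i : Fin d => (D i j.val).coeff 1))

/-- A polynomial vector annihilated by a linear matrix whose columns satisfy the independence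
condition of the T-normal form vanishes outside the zero columns. -/
theorem eq_zero_of_sum_mul_eq_zero {d r : ℕ} (D : Matrix (Fin d) (Fin r) ℚ[X])
    (hlin : ∀ i j, (D i j).degree ≤ 1) (J₁ J₂ J₃ : Finset (Fin r))
    (hcover : ∀ j : Fin r, j ∈ J₁ ∨ j ∈ J₂ ∨ j ∈ J₃) (h23 : Disjoint J₂ J₃)
    (h1 : ∀ j ∈ J₁, ∀ i, D i j = 0) (h2 : ∀ j ∈ J₂, ∀ i, (D i j).coeff 1 = 0)
    (hli : LinearIndependent ℚ (Sum.elim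
      (fun j : {j // j ∈ J₂} => fun i : Fin d => (D i j.val).coeff 0)
      (fun j : {j // j ∈ J₃} => fun i : Fin d => (D i j.val).coeff 1)))
    (u : Fin r → ℚ[X]) (hu : ∀ i, ∑ j, D i j * u j = 0) :
    (∀ j ∈ J₂, u j = 0) ∧ (∀ j ∈ J₃, u j = 0) := by
  have hcoeff (i : Fin d) (j : Fin r) (n : ℕ) : (D i j * u j).coeff n =
      (D i j).coeff 0 * (u j).coeff n + (D i j).coeff 1 * (X * u j).coeff n := by
    conv_lhs => rw [eq_X_add_C_of_degree_le_one (hlin i j)]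
    rw [add_mul, coeff_add, mul_assoc, coeff_C_mul, coeff_C_mul, add_comm]
  have step (n : ℕ) (hn : ∀ j ∈ J₃, (X * u j).coeff (n + 1) = 0) :
      (∀ j ∈ J₂, (u j).coeff n = 0) ∧ (∀ j ∈ J₃, (X * u j).coeff n = 0) := by
    have key := Fintype.linearIndependent_iff.mp hli
      (Sum.elim (fun j => (u j.val).coeff n) (fun j => (X * u j.val).coeff n)) (by
        ext i
        have h := congrArg (fun p => p.coeff n) (hu i)
        simp only [finsetSum_coeff, coeff_zero] at h
        rw [← Finset.sum_subset (Finset.subset_univ (J₂ ∪ J₃)), Finset.sum_union h23] at h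
        · simp only [Fintype.sum_sum_type, Sum.elim_inl, Sum.elim_inr,
            Finset.sum_apply, Pi.smul_apply, smul_eq_mul, Pi.zero_apply]
          refine (congrArg₂ (· + ·)
            (Finset.sum_coe_sort J₂ fun j : Fin r => (u j).coeff n * (D i j).coeff 0)
            (Finset.sum_coe_sort J₃ fun j : Fin r => (X * u j).coeff n * (D i j).coeff 1)).trans
            ((congrArg₂ (· + ·) ?_ ?_).trans h)
          · refine Finset.sum_congr rfl fun j hj => ?_
            rw [hcoeff, h2 j hj]
            ring
          · refine Finset.sum_congr rfl fun j hj => ?_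
            have h0 := hn j hj
            rw [coeff_X_mul] at h0
            rw [hcoeff, h0]
            ring
        · intro j _ hj
          rw [Finset.mem_union, not_or] at hj
          rw [h1 j (by have := hcover j; tauto), zero_mul, coeff_zero])
    exact ⟨fun j hj => key (Sum.inl ⟨j, hj⟩), fun j hj => key (Sum.inr ⟨j, hj⟩)⟩
  obtain ⟨M, hM⟩ : ∃ M, ∀ j, (X * u j).natDegree < M :=
    ⟨Finset.univ.sup (fun j => (X * u j).natDegree) + 1, fun j =>
      Nat.lt_succ_of_le (Finset.le_sup (f := fun j => (X * u j).natDegree) (Finset.mem_univ j))⟩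
  have hJ₃ (n : ℕ) : ∀ j ∈ J₃, (X * u j).coeff n = 0 := by
    rcases le_total M n with h | h
    · exact fun j _ => coeff_eq_zero_of_natDegree_lt ((hM j).trans_le h)
    · exact Nat.decreasingInduction' (fun k _ _ hk => (step k hk).2) h
        fun j _ => coeff_eq_zero_of_natDegree_lt (hM j)
  refine ⟨fun j hj => ?_, fun j hj => ?_⟩
  · ext n
    exact (step n (hJ₃ (n + 1))).1 j hj
  · ext n
    simpa using hJ₃ (n + 1) j hj

/-- If `D ∈ ℚ[x]^{d×r}` is a linear matrix in T-normal form and `D·U = 0`, then there is a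
unit `N` of `ℚ[x]^{r×r}` (determinant a nonzero rational constant, inverse with polynomial
entries) trivializing the relation: for each `i`, either the `i`-th column of `D·N` is zero
or the `i`-th row of `N⁻¹·U` is zero. -/
theorem tnormal_trivialization (d r s : ℕ) (D : Matrix (Fin d) (Fin r) ℚ[X])
    (hlin : ∀ i j, (D i j).degree ≤ 1) (hT : Matrix.IsTNormal D)
    (U : Matrix (Fin r) (Fin s) ℚ[X]) (hDU : D * U = 0) :
    ∃ N N' : Matrix (Fin r) (Fin r) ℚ[X],
      N * N' = 1 ∧ N' * N = 1 ∧
      (∃ c : ℚ, c ≠ 0 ∧ N.det = Polynomial.C c) ∧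
      (∀ i : Fin r, (∀ a : Fin d, (D * N) a i = 0) ∨ (∀ b : Fin s, (N' * U) i b = 0)) := by
  obtain ⟨J₁, J₂, J₃, hcover, -, -, h23, h1, h2, hli⟩ := hT
  refine ⟨1, 1, one_mul 1, one_mul 1, ⟨1, one_ne_zero, by simp⟩, fun i => ?_⟩
  rw [Matrix.mul_one, Matrix.one_mul]
  have hU (b : Fin s) := eq_zero_of_sum_mul_eq_zero D hlin J₁ J₂ J₃ hcover h23 h1 h2 hli
    (fun j => U j b) (fun a => congrFun (congrFun hDU a) b)
  rcases hcover i with hi | hi | hi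
  · exact Or.inl (h1 i hi)
  · exact Or.inr fun b => (hU b).1 i hi
  · exact Or.inr fun b => (hU b).2 i hi
end

section
/- Let C ∈ ℚ[x]^{k×d} be a linear matrix (all entries of degree at most 1). Then there exists a matrix M ∈ ℚ[x]^{d×d} whose determinant is a nonzero rational constant (so M is a unit of the matrix ring ℚ[x]^{d×d}) such that the product C·M is a linear matrix in T-normal form. -/
open Polynomial

section ColumnReduction

variable {F m n : Type*} [Field F]

/-- The leading vector of a column of linear polynomials: the `x`-coefficients, or the constant
coefficients if the column is scalar. -/
noncomputable def linearLead (c : m → F[X]) : m → F :=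
  open Classical in
  if ∀ i, (c i).coeff 1 = 0 then fun i => (c i).coeff 0 else fun i => (c i).coeff 1

/-- The weight of a column of linear polynomials: `0` for a zero column, `1` for a nonzero scalar
column, `2` otherwise. -/
noncomputable def columnWeight (c : m → F[X]) : ℕ :=
  open Classical in
  if c = 0 then 0 else if ∀ i, (c i).coeff 1 = 0 then 1 else 2

theorem columnWeight_le_one {c : m → F[X]} (h : ∀ i, (c i).coeff 1 = 0) :
    columnWeight c ≤ 1 := by
  unfold columnWeight
  split_ifs <;> simp

theorem columnWeight_eq_two {c : m → F[X]} (h : ¬ ∀ i, (c i).coeff 1 = 0) :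
    columnWeight c = 2 := by
  have hc : c ≠ 0 := by
    rintro rfl
    simp at h
  rw [columnWeight, if_neg hc, if_neg h]

theorem columnWeight_pos {c : m → F[X]} (h : c ≠ 0) : 0 < columnWeight c := by
  unfold columnWeight
  rw [if_neg h]
  split_ifs <;> simp

variable [Fintype n] [DecidableEq n]

/-- Replacing one column of the identity matrix by `u` gives a matrix of determinant `u j₀`. -/
theorem Matrix.det_one_updateCol {R : Type*} [CommRing R] (j₀ : n) (u : n → R) :
    ((1 : Matrix n n R).updateCol j₀ u).det = u j₀ := by
  rw [← Matrix.cramer_apply, Matrix.cramer_one]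
  rfl

theorem Matrix.mul_one_updateCol {R : Type*} [CommRing R] (A : Matrix m n R) (j₀ : n)
    (u : n → R) :
    A * (1 : Matrix n n R).updateCol j₀ u = A.updateCol j₀ (A.mulVec u) := by
  ext i j
  by_cases h : j = j₀
  · subst h
    simp [Matrix.mul_apply, Matrix.mulVec, dotProduct]
  · simp [Matrix.mul_apply, h, Matrix.one_apply]

/-- Replacing a column by one of smaller weight lowers the total weight. -/
theorem sum_columnWeight_updateCol_lt (A : Matrix m n F[X]) (j₀ : n) (c : m → F[X])
    (h : columnWeight c < columnWeight (A.col j₀)) :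
    ∑ j, columnWeight ((A.updateCol j₀ c).col j) < ∑ j, columnWeight (A.col j) := by
  have key : ∀ j, j ≠ j₀ → (A.updateCol j₀ c).col j = A.col j := fun j hj => by
    ext1 i
    simp [Matrix.col, hj]
  have key₀ : (A.updateCol j₀ c).col j₀ = c := by
    ext1 i
    simp [Matrix.col]
  refine Finset.sum_lt_sum (fun j _ => ?_) ⟨j₀, Finset.mem_univ _, by rwa [key₀]⟩
  by_cases hj : j = j₀
  · subst hj
    rw [key₀]
    exact h.le
  · rw [key j hj]

/-- A linear dependency among the leading vectors of the nonzero columns of a linear matrix yields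
a column operation lowering the total weight. -/
theorem exists_column_operation (A : Matrix m n F[X]) (hA : ∀ i j, (A i j).degree ≤ 1)
    (hdep : ¬ LinearIndepOn F (fun j => linearLead (A.col j)) {j | A.col j ≠ 0}) :
    ∃ T : Matrix n n F[X], (∃ c : F, c ≠ 0 ∧ T.det = C c) ∧
      (∀ i j, ((A * T) i j).degree ≤ 1) ∧
      ∑ j, columnWeight ((A * T).col j) < ∑ j, columnWeight (A.col j) := by
  classical
  rw [linearIndepOn_iff] at hdep
  push Not at hdep
  obtain ⟨g, hg, hsum, hne⟩ := hdep
  replace hsum : ∀ i, ∑ j, g j * linearLead (A.col j) i = 0 := fun i => by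
    rw [Finsupp.linearCombination_apply, Finsupp.sum_fintype _ _ (by simp)] at hsum
    simpa using congrFun hsum i
  suffices H : ∃ (j₀ : n) (u : n → F[X]), (∃ c : F, c ≠ 0 ∧ u j₀ = C c) ∧
      (∀ i, ((A.mulVec u) i).degree ≤ 1) ∧
      columnWeight (A.mulVec u) < columnWeight (A.col j₀) by
    obtain ⟨j₀, u, hu, hdeg, hw⟩ := H
    refine ⟨(1 : Matrix n n F[X]).updateCol j₀ u, ?_, ?_, ?_⟩
    · rwa [Matrix.det_one_updateCol]
    · intro i j
      rw [Matrix.mul_one_updateCol, Matrix.updateCol_apply]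
      split_ifs
      exacts [hdeg i, hA i j]
    · rw [Matrix.mul_one_updateCol]
      exact sum_columnWeight_updateCol_lt A j₀ _ hw
  have hscalar : ∀ j, (∀ i, (A.col j i).coeff 1 = 0) → ∀ i, A i j = C ((A i j).coeff 0) :=
    fun j hj i => by
      have h := eq_X_add_C_of_degree_le_one (hA i j)
      rwa [show (A i j).coeff 1 = 0 from hj i, C_0, zero_mul, zero_add] at h
  by_cases hcase : ∃ j, g j ≠ 0 ∧ ¬ ∀ i, (A.col j i).coeff 1 = 0
  · obtain ⟨j₀, hj₀, hns⟩ := hcase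
    have hterm : ∀ i j, (A i j * (C (g j) * if ∀ i, (A.col j i).coeff 1 = 0 then X else 1)).degree
        ≤ 1 ∧ (A i j * (C (g j) * if ∀ i, (A.col j i).coeff 1 = 0 then X else 1)).coeff 1 =
          g j * linearLead (A.col j) i := fun i j => by
      unfold linearLead
      split_ifs with hs
      · rw [hscalar j hs i, ← mul_assoc, ← C_mul]
        refine ⟨degree_C_mul_X_le _, ?_⟩
        simp [Matrix.col, mul_comm]
      · rw [mul_one, mul_comm]
        rw [← smul_eq_C_mul]
        refine ⟨(degree_smul_le _ _).trans (hA i j), ?_⟩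
        simp [Matrix.col]
    refine ⟨j₀, fun j => C (g j) * if ∀ i, (A.col j i).coeff 1 = 0 then X else 1,
      ⟨g j₀, hj₀, by simp only [if_neg hns, mul_one]⟩, fun i => ?_, ?_⟩
    · exact (degree_sum_le _ _).trans (Finset.sup_le fun j _ => (hterm i j).1)
    · rw [columnWeight_eq_two hns]
      refine Nat.lt_succ_of_le (columnWeight_le_one fun i => ?_)
      rw [Matrix.mulVec, dotProduct, finsetSum_coeff]
      refine Eq.trans ?_ (hsum i)
      exact Finset.sum_congr rfl fun j _ => (hterm i j).2
  · push Not at hcase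
    obtain ⟨j₀, hj₀⟩ := Finsupp.ne_iff.mp hne
    have hzero : A.mulVec (fun j => C (g j)) = 0 := by
      ext1 i
      rw [Matrix.mulVec, dotProduct, Pi.zero_apply, ← C_0, ← hsum i, map_sum]
      refine Finset.sum_congr rfl fun j _ => ?_
      by_cases hj : g j = 0
      · simp [hj]
      · rw [linearLead, if_pos (hcase j hj), C_mul, mul_comm, hscalar j (hcase j hj) i]
        simp [Matrix.col]
    refine ⟨j₀, fun j => C (g j), ⟨g j₀, hj₀, rfl⟩, fun i => by simp [hzero], ?_⟩
    rw [hzero]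
    have hmem : A.col j₀ ≠ 0 := hg (Finsupp.mem_support_iff.mpr hj₀)
    simpa [columnWeight] using columnWeight_pos hmem

end ColumnReduction

/-- A linear matrix whose nonzero columns have independent leading vectors is in T-normal form. -/
theorem Matrix.isTNormal_of_linearIndepOn {d r : ℕ} (D : Matrix (Fin d) (Fin r) ℚ[X])
    (h : LinearIndepOn ℚ (fun j => linearLead (D.col j)) {j | D.col j ≠ 0}) :
    D.IsTNormal := by
  classical
  let J₁ : Finset (Fin r) := {j | D.col j = 0}
  let J₂ : Finset (Fin r) := {j | D.col j ≠ 0 ∧ ∀ i, (D.col j i).coeff 1 = 0}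
  let J₃ : Finset (Fin r) := {j | ¬ ∀ i, (D.col j i).coeff 1 = 0}
  have h₂ : ∀ j ∈ J₂, D.col j ≠ 0 ∧ ∀ i, (D.col j i).coeff 1 = 0 :=
    fun j hj => (Finset.mem_filter.mp hj).2
  have h₃ : ∀ j ∈ J₃, ¬ ∀ i, (D.col j i).coeff 1 = 0 :=
    fun j hj => (Finset.mem_filter.mp hj).2
  have h₃' : ∀ j ∈ J₃, D.col j ≠ 0 := fun j hj h0 => h₃ j hj fun i => by rw [h0, Pi.zero_apply, coeff_zero]
  have h₁ : ∀ j ∈ J₁, D.col j = 0 := fun j hj => (Finset.mem_filter.mp hj).2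
  have h₂₃ : Disjoint J₂ J₃ := Finset.disjoint_left.mpr fun j h2 h3 => h₃ j h3 (h₂ j h2).2
  refine ⟨J₁, J₂, J₃, fun j => ?_, Finset.disjoint_left.mpr fun j h1 h2 => (h₂ j h2).1 (h₁ j h1),
    Finset.disjoint_left.mpr fun j h1 h3 => h₃' j h3 (h₁ j h1), h₂₃,
    fun j hj i => congrFun (h₁ j hj) i, fun j hj => (h₂ j hj).2, ?_⟩
  · simp only [J₁, J₂, J₃, Finset.mem_filter_univ]
    tauto
  · let e : {j // j ∈ J₂} ⊕ {j // j ∈ J₃} → {j | D.col j ≠ 0} :=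
      Sum.elim (fun j => ⟨j, (h₂ j j.2).1⟩) (fun j => ⟨j, h₃' j j.2⟩)
    have he : Function.Injective e := by
      refine Function.Injective.sumElim (fun a b hab => ?_) (fun a b hab => ?_) fun a b hab => ?_
      · exact Subtype.ext (Subtype.mk.inj hab)
      · exact Subtype.ext (Subtype.mk.inj hab)
      · exact Finset.disjoint_left.mp h₂₃ a.2 ((congrArg Subtype.val hab : a.1 = b.1) ▸ b.2)
    convert LinearIndependent.comp h e he using 1
    ext1 (j | j)
    · exact (if_pos (h₂ j j.2).2).symm
    · exact (if_neg (h₃ j j.2)).symm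

/-- Every linear matrix `C ∈ ℚ[x]^{k×d}` can be brought into T-normal form by
post-multiplication with a unit `M` of the matrix ring `ℚ[x]^{d×d}` (a matrix whose
determinant is a nonzero rational constant). -/
theorem tnormal_form_exists (k d : ℕ) (C : Matrix (Fin k) (Fin d) ℚ[X])
    (hlin : ∀ i j, (C i j).degree ≤ 1) :
    ∃ M : Matrix (Fin d) (Fin d) ℚ[X],
      (∃ c : ℚ, c ≠ 0 ∧ M.det = Polynomial.C c) ∧
      (∀ i j, ((C * M) i j).degree ≤ 1) ∧
      Matrix.IsTNormal (C * M) := by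
  induction hw : ∑ j, columnWeight (C.col j) using Nat.strong_induction_on generalizing C with
  | _ w ih =>
    by_cases h : LinearIndepOn ℚ (fun j => linearLead (C.col j)) {j | C.col j ≠ 0}
    · exact ⟨1, ⟨1, one_ne_zero, by simp⟩, by simpa using hlin,
        by simpa using C.isTNormal_of_linearIndepOn h⟩
    · obtain ⟨T, ⟨a, ha, hT⟩, hdeg, hlt⟩ := exists_column_operation C hlin h
      obtain ⟨M, ⟨b, hb, hM⟩, hdegM, hnormal⟩ := ih _ (hw ▸ hlt) (C * T) hdeg rfl
      rw [Matrix.mul_assoc] at hnormal hdegM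
      exact ⟨T * M, ⟨a * b, mul_ne_zero ha hb, by rw [Matrix.det_mul, hT, hM, C_mul]⟩,
        hdegM, hnormal⟩
end

section
/- Let C ∈ ℚ[x]^{d×r} be a linear matrix (all entries of degree at most 1) and let U ∈ ℚ[x]^{r×s} be a matrix of polynomials with C·U = 0. Then there exists an invertible matrix N ∈ ℚ[x]^{r×r} with N⁻¹ ∈ ℚ[x]^{r×r} (equivalently, det N is a nonzero rational constant) such that for every index i ∈ {1,…,r}, either the i-th column of C·N is zero or the i-th row of N⁻¹·U is zero. -/
open Polynomial

/-- Over a principal ideal domain, the kernel of a linear map out of `Rⁿ` into a finite free module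
is a direct summand, so some basis of `Rⁿ` splits into vectors of the kernel and vectors whose
coordinate functionals vanish on the kernel. -/
theorem exists_basis_mem_ker_or_repr_eq_zero {R L : Type*} [CommRing R] [IsDomain R]
    [IsPrincipalIdealRing R] [AddCommGroup L] [Module R L] [Module.Free R L] [Module.Finite R L]
    (r : ℕ) (f : (Fin r → R) →ₗ[R] L) :
    ∃ b : Module.Basis (Fin r) R (Fin r → R),
      ∀ i, f (b i) = 0 ∨ ∀ x, f x = 0 → b.repr x i = 0 := by
  obtain ⟨g, hg⟩ := Module.projective_lifting_property f.rangeRestrict LinearMap.id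
    f.surjective_rangeRestrict
  have hg' : ∀ y, f (g y) = y := fun y => congrArg Subtype.val (LinearMap.congr_fun hg y)
  let e : (LinearMap.ker f × LinearMap.range f) ≃ₗ[R] (Fin r → R) :=
    LinearEquiv.ofLinearMap
      (LinearMap.coprod (LinearMap.ker f).subtype g)
      (LinearMap.prod
        (LinearMap.codRestrict (LinearMap.ker f) (LinearMap.id - g ∘ₗ f.rangeRestrict)
          (fun x => by simp [hg']))
        f.rangeRestrict)
      (by ext; simp)
      (by
        apply LinearMap.ext
        rintro ⟨⟨x, hx⟩, y⟩
        have hx' : f.rangeRestrict x = 0 := Subtype.ext hx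
        have hy : f.rangeRestrict (g y) = y := LinearMap.congr_fun hg y
        ext1
        · ext1
          simp [hx', hy]
        · simp [hx', hy])
  have hsymm : ∀ x, (e.symm x).2 = f.rangeRestrict x := fun x => rfl
  let b₀ := ((Module.Free.chooseBasis R (LinearMap.ker f)).prod
    (Module.Free.chooseBasis R (LinearMap.range f))).map e
  let σ := b₀.indexEquiv (Pi.basisFun R (Fin r))
  refine ⟨b₀.reindex σ, fun i => ?_⟩
  obtain ⟨j, rfl⟩ := σ.surjective i
  rcases j with j | j
  · left
    simp [b₀, e]
  · right
    intro x hx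
    have hx' : f.rangeRestrict x = 0 := Subtype.ext hx
    simp [b₀, hsymm, hx']

/-- Trivialization of matrix relations over `ℚ[x]`: if `C ∈ ℚ[x]^{d×r}` is a linear matrix
(entries of degree ≤ 1) and `U ∈ ℚ[x]^{r×s}` satisfies `C·U = 0`, then there is an invertible
`N ∈ ℚ[x]^{r×r}` with inverse `N'` also over `ℚ[x]` (equivalently, `det N` is a nonzero
rational constant) such that for each `i`, either the `i`-th column of `C·N` is zero or the
`i`-th row of `N⁻¹·U` is zero. -/
theorem trivialize_relation_Qx (d r s : ℕ) (C : Matrix (Fin d) (Fin r) ℚ[X])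
    (hlin : ∀ i j, (C i j).degree ≤ 1)
    (U : Matrix (Fin r) (Fin s) ℚ[X]) (hCU : C * U = 0) :
    ∃ N N' : Matrix (Fin r) (Fin r) ℚ[X],
      N * N' = 1 ∧ N' * N = 1 ∧
      (∃ c : ℚ, c ≠ 0 ∧ N.det = Polynomial.C c) ∧
      (∀ i : Fin r, (∀ a : Fin d, (C * N) a i = 0) ∨ (∀ b : Fin s, (N' * U) i b = 0)) := by
  obtain ⟨b, hb⟩ := exists_basis_mem_ker_or_repr_eq_zero r C.mulVecLin
  let std := Pi.basisFun ℚ[X] (Fin r)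
  have hmul : std.toMatrix b * b.toMatrix std = 1 := std.toMatrix_mul_toMatrix_flip b
  refine ⟨std.toMatrix b, b.toMatrix std, hmul, b.toMatrix_mul_toMatrix_flip std, ?_, fun i => ?_⟩
  · obtain ⟨c, hc, h⟩ := Polynomial.isUnit_iff.mp
      ((Matrix.isUnit_iff_isUnit_det _).mp (IsUnit.of_mul_eq_one _ hmul))
    exact ⟨c, hc.ne_zero, h.symm⟩
  · refine (hb i).imp (fun h a => ?_) (fun h k => ?_)
    · exact congrFun h a
    · have hU : C.mulVecLin (U.col k) = 0 := funext fun a => congrFun (congrFun hCU a) k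
      have hcoord := congrFun (Module.Basis.toMatrix_mulVec_repr std b (U.col k)) i
      rw [h _ hU] at hcoord
      exact hcoord
end

section
/- Let L = A₀ + A₁x ∈ ℚ[x]^{d×d} be a linear matrix such that det L ≠ 0 (L is full), det L is not a nonzero constant (L is not a unit), and A₁ is not invertible (L is not monic). Then there exist ℓ with 0 < ℓ < d, a unit U ∈ ℚ[x]^{d×d}, an invertible scalar matrix S ∈ ℚ^{d×d}, and a monic linear matrix W = B₀ + B₁x ∈ ℚ[x]^{(d−ℓ)×(d−ℓ)} with det W ≠ 0, such that U·L·S equals the block-diagonal matrix W ⊕ I_ℓ. -/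
open Polynomial

namespace Matrix

variable {K ι κ : Type*} [Field K]

/-- The linear matrix `A₀ + A₁ x` over `K[x]`. -/
noncomputable def pencil (A₀ A₁ : Matrix ι ι K) : Matrix ι ι K[X] :=
  A₀.map C + (X : K[X]) • A₁.map C

theorem pencil_apply (A₀ A₁ : Matrix ι ι K) (i j : ι) :
    pencil A₀ A₁ i j = C (A₀ i j) + C (A₁ i j) * X := by
  simp [pencil]

theorem map_mul_pencil_mul_map [Fintype ι] (A₀ A₁ P Q : Matrix ι ι K) :
    P.map C * pencil A₀ A₁ * Q.map C = pencil (P * A₀ * Q) (P * A₁ * Q) := by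
  simp [pencil, Matrix.mul_add, Matrix.add_mul, Matrix.map_mul]

theorem isUnit_map_C [Fintype ι] [DecidableEq ι] {P : Matrix ι ι K} (hP : IsUnit P) :
    IsUnit (P.map (C : K →+* K[X])) :=
  hP.map (C : K →+* K[X]).mapMatrix

theorem isUnit_submatrix_equiv_equiv {R : Type*} [CommRing R] [Fintype ι] [DecidableEq ι]
    [Fintype κ] [DecidableEq κ] {P : Matrix ι ι R} (hP : IsUnit P) (e f : κ ≃ ι) :
    IsUnit (P.submatrix e f) := by
  rwa [isUnit_submatrix_equiv]

theorem coeff_det_pencil [Fintype ι] [DecidableEq ι] (A₀ A₁ : Matrix ι ι K) :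
    (pencil A₀ A₁).det.coeff (Fintype.card ι) = A₁.det := by
  rw [pencil, add_comm]
  exact coeff_det_X_add_C_card A₁ A₀

theorem natDegree_det_pencil_le [Fintype ι] [DecidableEq ι] (A₀ A₁ : Matrix ι ι K) :
    (pencil A₀ A₁).det.natDegree ≤ Fintype.card ι := by
  rw [pencil, add_comm]
  exact natDegree_det_X_add_C_le A₁ A₀

/-- A nonzero vector occurs as any prescribed row of some invertible matrix. -/
theorem exists_isUnit_row_eq [Fintype ι] [DecidableEq ι] {v : ι → K} (hv : v ≠ 0) (i : ι) :
    ∃ P : Matrix ι ι K, IsUnit P ∧ P i = v := by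
  obtain ⟨j, hj⟩ := Function.ne_iff.mp hv
  refine ⟨((1 : Matrix ι ι K).updateRow j v).submatrix (Equiv.swap i j) (Equiv.refl ι),
    isUnit_submatrix_equiv_equiv ?_ _ _, ?_⟩
  · rw [isUnit_iff_isUnit_det]
    have h : ((1 : Matrix ι ι K).updateRow j v).det = v j := by
      rw [← cramer_transpose_apply, transpose_one, cramer_one, Module.End.one_apply]
    rw [h]
    exact isUnit_iff_ne_zero.mpr hj
  · ext k
    simp

/-- `L` is equivalent, through a polynomial unit on the left and a scalar one on the right,
to the direct sum of a monic linear matrix and an identity matrix. -/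
def HasMonicReduction [Fintype ι] [DecidableEq ι] (L : Matrix ι ι K[X]) : Prop :=
  ∃ (μ ν : Type) (_ : Fintype μ) (_ : DecidableEq μ) (_ : Fintype ν) (_ : DecidableEq ν)
    (e : μ ⊕ ν ≃ ι) (U : Matrix ι ι K[X]) (S : Matrix ι ι K) (B₀ B₁ : Matrix μ μ K),
    IsUnit U ∧ IsUnit S ∧ IsUnit B₁ ∧
      (U * L * S.map C).submatrix e e = fromBlocks (pencil B₀ B₁) 0 0 1

theorem HasMonicReduction.of_mul [Fintype ι] [DecidableEq ι] {L P : Matrix ι ι K[X]}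
    {Q : Matrix ι ι K} (hP : IsUnit P) (hQ : IsUnit Q)
    (h : HasMonicReduction (P * L * Q.map C)) : HasMonicReduction L := by
  obtain ⟨μ, ν, _, _, _, _, e, U, S, B₀, B₁, hU, hS, hB, h⟩ := h
  refine ⟨μ, ν, inferInstance, inferInstance, inferInstance, inferInstance, e,
    U * P, Q * S, B₀, B₁, hU.mul hP, hQ.mul hS, hB, ?_⟩
  rw [← h, Matrix.map_mul]
  simp only [Matrix.mul_assoc]

theorem HasMonicReduction.of_submatrix_equiv [Fintype ι] [DecidableEq ι] [Fintype κ]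
    [DecidableEq κ] {L : Matrix ι ι K[X]} (f : κ ≃ ι)
    (h : HasMonicReduction (L.submatrix f f)) : HasMonicReduction L := by
  obtain ⟨μ, ν, _, _, _, _, e, U, S, B₀, B₁, hU, hS, hB, h⟩ := h
  refine ⟨μ, ν, inferInstance, inferInstance, inferInstance, inferInstance, e.trans f,
    U.submatrix f.symm f.symm, S.submatrix f.symm f.symm,
    B₀, B₁, isUnit_submatrix_equiv_equiv hU _ _, isUnit_submatrix_equiv_equiv hS _ _, hB, ?_⟩
  have hprod : U.submatrix f.symm f.symm * L * (S.submatrix f.symm f.symm).map C =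
      (U * L.submatrix f f * S.map C).submatrix f.symm f.symm := by
    rw [← submatrix_mul_equiv _ _ _ f.symm, ← submatrix_mul_equiv _ _ _ f.symm]
    simp [submatrix_map]
  rw [← h, hprod]
  ext1 i j
  simp

theorem HasMonicReduction.fromBlocks_one [Fintype ι] [DecidableEq ι] {L : Matrix ι ι K[X]}
    (h : HasMonicReduction L) :
    HasMonicReduction (fromBlocks L 0 0 (1 : Matrix Unit Unit K[X])) := by
  obtain ⟨μ, ν, _, _, _, _, e, U, S, B₀, B₁, hU, hS, hB, h⟩ := h
  refine ⟨μ, ν ⊕ Unit, inferInstance, inferInstance, inferInstance, inferInstance,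
    (Equiv.sumAssoc μ ν Unit).symm.trans (e.sumCongr (Equiv.refl Unit)),
    fromBlocks U 0 0 1, fromBlocks S 0 0 1, B₀, B₁, ?_, ?_, hB, ?_⟩
  · simpa [isUnit_iff_isUnit_det] using hU
  · simpa [isUnit_iff_isUnit_det] using hS
  · rw [fromBlocks_map, fromBlocks_multiply, fromBlocks_multiply]
    simp only [Matrix.mul_zero, Matrix.zero_mul, add_zero, zero_add, Matrix.mul_one,
      Matrix.map_zero _ (map_zero C), Matrix.map_one _ (map_zero C) (map_one C)]
    generalize U * L * S.map C = Y at h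
    have hY : ∀ i j, Y (e i) (e j) = fromBlocks (pencil B₀ B₁) 0 0 1 i j :=
      fun i j => congrFun (congrFun h i) j
    ext1 (i | i | i) (j | j | j) <;> simp [hY, one_apply]

theorem hasMonicReduction_of_isUnit {ι : Type} [Fintype ι] [DecidableEq ι]
    (A₀ : Matrix ι ι K) {A₁ : Matrix ι ι K}
    (h : IsUnit A₁) : HasMonicReduction (pencil A₀ A₁) := by
  refine ⟨ι, Empty, inferInstance, inferInstance, inferInstance, inferInstance, Equiv.sumEmpty ι Empty,
    1, 1, A₀, A₁, isUnit_one, isUnit_one, h, ?_⟩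
  ext1 (i | i) (j | j)
  · simp
  · exact j.elim
  · exact i.elim
  · exact i.elim

/-- A full linear matrix with singular leading coefficient splits off an identity block
of size one. -/
theorem exists_pencil_deflation [Fintype ι] [DecidableEq ι]
    {A₀ A₁ : Matrix (ι ⊕ Unit) (ι ⊕ Unit) K}
    (hfull : (pencil A₀ A₁).det ≠ 0) (hA : ¬ IsUnit A₁) :
    ∃ (P : Matrix (ι ⊕ Unit) (ι ⊕ Unit) K[X]) (Q : Matrix (ι ⊕ Unit) (ι ⊕ Unit) K)
      (B₀ B₁ : Matrix ι ι K), IsUnit P ∧ IsUnit Q ∧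
      P * pencil A₀ A₁ * Q.map C = fromBlocks (pencil B₀ B₁) 0 0 1 := by
  obtain ⟨v, hv, hvA⟩ := exists_vecMul_eq_zero_iff.mpr
    (by simpa [isUnit_iff_isUnit_det] using hA : A₁.det = 0)
  have hw : v ᵥ* A₀ ≠ 0 := by
    intro hw
    refine hfull (exists_vecMul_eq_zero_iff.mp ⟨C ∘ v, ?_, ?_⟩)
    · intro h
      exact hv (funext fun i => C_injective (by simpa using congrFun h i))
    · have h₀ := RingHom.map_vecMul (C : K →+* K[X]) A₀ v
      have h₁ := RingHom.map_vecMul (C : K →+* K[X]) A₁ v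
      ext1 j
      simp only [pencil, vecMul_add, vecMul_smul, Pi.add_apply, Pi.smul_apply, ← h₀, ← h₁, hw,
        hvA]
      simp
  obtain ⟨P, hP, hPv⟩ := exists_isUnit_row_eq hv (Sum.inr ())
  obtain ⟨R, hR, hRw⟩ := exists_isUnit_row_eq hw (Sum.inr ())
  have hRR : R * R⁻¹ = 1 := mul_nonsing_inv R ((isUnit_iff_isUnit_det R).mp hR)
  set D₀ := P * A₀ * R⁻¹ with hD₀
  set D₁ := P * A₁ * R⁻¹ with hD₁
  have row₀ : D₀ (Sum.inr ()) = (1 : Matrix (ι ⊕ Unit) (ι ⊕ Unit) K) (Sum.inr ()) := by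
    rw [hD₀, mul_apply_eq_vecMul, mul_apply_eq_vecMul, hPv, ← hRw, ← mul_apply_eq_vecMul, hRR]
  have row₁ : D₁ (Sum.inr ()) = 0 := by
    rw [hD₁, mul_apply_eq_vecMul, mul_apply_eq_vecMul, hPv, hvA, zero_vecMul]
  set b := (pencil D₀ D₁).toBlocks₁₂ with hb
  have hblocks : pencil D₀ D₁ = fromBlocks (pencil D₀.toBlocks₁₁ D₁.toBlocks₁₁) b 0 1 := by
    ext1 (i | i) (j | j)
    · simp [pencil_apply, toBlocks₁₁]
    · simp [hb, toBlocks₁₂]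
    · simp [pencil_apply, row₀, row₁]
    · simp [pencil_apply, row₀, row₁]
  refine ⟨fromBlocks 1 (-b) 0 1 * P.map C, R⁻¹, D₀.toBlocks₁₁, D₁.toBlocks₁₁,
    IsUnit.mul ?_ (isUnit_map_C hP), isUnit_nonsing_inv_iff.mpr hR, ?_⟩
  · simp [isUnit_iff_isUnit_det]
  · rw [Matrix.mul_assoc, Matrix.mul_assoc, ← Matrix.mul_assoc (P.map C),
      map_mul_pencil_mul_map, ← hD₀, ← hD₁, hblocks, fromBlocks_multiply]
    simp

theorem hasMonicReduction_pencil (n : ℕ) (A₀ A₁ : Matrix (Fin n) (Fin n) K)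
    (hfull : (pencil A₀ A₁).det ≠ 0) : HasMonicReduction (pencil A₀ A₁) := by
  induction n with
  | zero => exact hasMonicReduction_of_isUnit A₀ (isUnit_of_subsingleton A₁)
  | succ n ih =>
    by_cases hA : IsUnit A₁
    · exact hasMonicReduction_of_isUnit A₀ hA
    let f : Fin n ⊕ Unit ≃ Fin (n + 1) :=
      ((Equiv.refl _).sumCongr finOneEquiv.symm).trans finSumFinEquiv
    refine HasMonicReduction.of_submatrix_equiv f ?_
    have hsub : (pencil A₀ A₁).submatrix f f = pencil (A₀.submatrix f f) (A₁.submatrix f f) :=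
      rfl
    rw [← det_submatrix_equiv_self f, hsub] at hfull
    rw [hsub]
    obtain ⟨P, Q, B₀, B₁, hP, hQ, h⟩ := exists_pencil_deflation hfull
      (by rwa [isUnit_submatrix_equiv])
    refine HasMonicReduction.of_mul hP hQ ?_
    rw [h]
    refine (ih B₀ B₁ fun h0 => ?_).fromBlocks_one
    have hdet := congrArg det h
    rw [det_mul, det_mul, det_fromBlocks_zero₂₁, h0, zero_mul] at hdet
    have hPd := ((isUnit_iff_isUnit_det _).mp hP).ne_zero
    have hQd := ((isUnit_iff_isUnit_det _).mp (isUnit_map_C hQ)).ne_zero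
    exact mul_ne_zero (mul_ne_zero hPd hfull) hQd hdet

end Matrix

open Matrix in
/-- Making a full non-unit, non-monic linear matrix over `ℚ[x]` monic: there are a unit `U`
of `ℚ[x]^{d×d}` and an invertible scalar matrix `S` with `U·L·S = W ⊕ I_ℓ` for some monic
full linear matrix `W` of strictly smaller size. -/
theorem monicity_left (d : ℕ) (A₀ A₁ : Matrix (Fin d) (Fin d) ℚ)
    (L : Matrix (Fin d) (Fin d) ℚ[X])
    (hL : ∀ i j, L i j = Polynomial.C (A₀ i j) + Polynomial.C (A₁ i j) * X)
    (hfull : L.det ≠ 0)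
    (hnonunit : ¬ ∃ c : ℚ, c ≠ 0 ∧ L.det = Polynomial.C c)
    (hnonmonic : ¬ IsUnit A₁) :
    ∃ (ℓ : ℕ) (hℓ : ℓ < d), 0 < ℓ ∧
      ∃ (U : Matrix (Fin d) (Fin d) ℚ[X]) (S : Matrix (Fin d) (Fin d) ℚ)
        (W : Matrix (Fin (d - ℓ)) (Fin (d - ℓ)) ℚ[X])
        (B₀ B₁ : Matrix (Fin (d - ℓ)) (Fin (d - ℓ)) ℚ),
        IsUnit U ∧ IsUnit S ∧
        (∀ i j, W i j = Polynomial.C (B₀ i j) + Polynomial.C (B₁ i j) * X) ∧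
        IsUnit B₁ ∧ W.det ≠ 0 ∧
        U * L * S.map Polynomial.C =
          Matrix.reindex (finSumFinEquiv.trans (finCongr (Nat.sub_add_cancel hℓ.le)))
            (finSumFinEquiv.trans (finCongr (Nat.sub_add_cancel hℓ.le)))
            (Matrix.fromBlocks W 0 0 (1 : Matrix (Fin ℓ) (Fin ℓ) ℚ[X])) := by
  obtain rfl : L = pencil A₀ A₁ := by
    ext1 i j
    rw [hL, pencil_apply]
  obtain ⟨μ, ν, _, _, _, _, e, U, S, B₀, B₁, hU, hS, hB, h⟩ :=
    hasMonicReduction_pencil d A₀ A₁ hfull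
  have hcard : Fintype.card μ + Fintype.card ν = d := by
    simpa using Fintype.card_congr e
  have hassoc : Associated (pencil A₀ A₁).det (pencil B₀ B₁).det := by
    have hdet := congrArg det h
    rw [det_submatrix_equiv_self, det_mul, det_mul, det_fromBlocks_zero₂₁, det_one,
      mul_one] at hdet
    rw [← hdet]
    have hUd := (isUnit_iff_isUnit_det _).mp hU
    have hSd := (isUnit_iff_isUnit_det _).mp (isUnit_map_C hS)
    exact (associated_unit_mul_left _ _ hUd).symm.trans
      (associated_mul_unit_left _ _ hSd).symm
  have hB' : B₁.det ≠ 0 := ((isUnit_iff_isUnit_det _).mp hB).ne_zero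
  have hμ : 0 < Fintype.card μ := by
    rw [Fintype.card_pos_iff]
    by_contra hμ
    rw [not_nonempty_iff] at hμ
    rw [det_isEmpty (A := pencil B₀ B₁), associated_one_iff_isUnit, Polynomial.isUnit_iff] at hassoc
    obtain ⟨c, hc, hdet⟩ := hassoc
    exact hnonunit ⟨c, hc.ne_zero, hdet.symm⟩
  have hν : 0 < Fintype.card ν := by
    by_contra hν
    apply hnonmonic
    have hdeg := natDegree_eq_of_degree_eq (degree_eq_degree_of_associated hassoc)
    have hdegB : (pencil B₀ B₁).det.natDegree = d := by
      refine (natDegree_eq_of_le_of_coeff_ne_zero (natDegree_det_pencil_le B₀ B₁) ?_).trans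
        (by omega)
      rwa [coeff_det_pencil]
    have hcoeff := coeff_det_pencil A₀ A₁
    have hcard' : Fintype.card (Fin d) = (pencil A₀ A₁).det.natDegree := by
      rw [Fintype.card_fin, hdeg, hdegB]
    rw [hcard', coeff_natDegree] at hcoeff
    rw [isUnit_iff_isUnit_det, ← hcoeff, isUnit_iff_ne_zero]
    exact leadingCoeff_ne_zero.mpr hfull
  have hℓ : Fintype.card ν < d := by omega
  let eμ : μ ≃ Fin (d - Fintype.card ν) := Fintype.equivFinOfCardEq (by omega)
  let eν : ν ≃ Fin (Fintype.card ν) := Fintype.equivFin ν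
  let g := finSumFinEquiv.trans (finCongr (Nat.sub_add_cancel hℓ.le))
  let σ : Fin d ≃ Fin d := g.symm.trans ((eμ.sumCongr eν).symm.trans e)
  have hsub : pencil (B₀.submatrix eμ.symm eμ.symm) (B₁.submatrix eμ.symm eμ.symm) =
      (pencil B₀ B₁).submatrix eμ.symm eμ.symm := rfl
  refine ⟨Fintype.card ν, hℓ, hν, U.submatrix σ (Equiv.refl _), S.submatrix (Equiv.refl _) σ,
    pencil (B₀.submatrix eμ.symm eμ.symm) (B₁.submatrix eμ.symm eμ.symm), _, _,
    isUnit_submatrix_equiv_equiv hU _ _, isUnit_submatrix_equiv_equiv hS _ _,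
    pencil_apply _ _, isUnit_submatrix_equiv_equiv hB _ _, ?_, ?_⟩
  · rw [hsub, det_submatrix_equiv_self]
    exact hassoc.ne_zero_iff.mp hfull
  · have hleft : U.submatrix σ (Equiv.refl _) * pencil A₀ A₁ *
        (S.submatrix (Equiv.refl _) σ).map C =
        ((U * pencil A₀ A₁ * S.map C).submatrix e e).submatrix
          (g.symm.trans (eμ.sumCongr eν).symm) (g.symm.trans (eμ.sumCongr eν).symm) := rfl
    rw [hleft, h, hsub, reindex_apply]
    have hblocks : (fromBlocks (pencil B₀ B₁) 0 0 (1 : Matrix ν ν ℚ[X])).submatrix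
        (eμ.sumCongr eν).symm (eμ.sumCongr eν).symm =
        fromBlocks ((pencil B₀ B₁).submatrix eμ.symm eμ.symm) 0 0 1 := by
      ext1 (i | i) (j | j) <;> simp [one_apply]
    rw [← hblocks]
    rfl
end

section
/- Let L = A₀ + A₁x ∈ ℚ[x]^{d×d} be a linear matrix such that det L ≠ 0 (L is full), det L is not a nonzero constant (L is not a unit), and A₁ is not invertible (L is not monic). Then there exist ℓ' with 0 < ℓ' < d, an invertible scalar matrix S' ∈ ℚ^{d×d}, a unit U' ∈ ℚ[x]^{d×d}, and a monic linear matrix W' = B₀' + B₁'x ∈ ℚ[x]^{(d−ℓ')×(d−ℓ')} with det W' ≠ 0, such that S'·L·U' equals the block-diagonal matrix W' ⊕ I_{ℓ'}. -/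
open Polynomial

/-- Fitting decomposition of a square matrix over a field: up to conjugation it is the direct sum
of an invertible and a nilpotent matrix. -/
theorem Matrix.exists_fitting {K n : Type*} [Field K] [Fintype n] [DecidableEq n]
    (E : Matrix n n K) :
    ∃ (m k : ℕ) (Q : Matrix (Fin m ⊕ Fin k) n K) (Q' : Matrix n (Fin m ⊕ Fin k) K)
      (E₁ : Matrix (Fin m) (Fin m) K) (N : Matrix (Fin k) (Fin k) K),
      m + k = Fintype.card n ∧ Q * Q' = 1 ∧ Q' * Q = 1 ∧ IsUnit E₁ ∧ IsNilpotent N ∧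
        Q * E * Q' = Matrix.fromBlocks E₁ 0 0 N := by
  set f : Module.End K (n → K) := Matrix.toLin' E with hf
  obtain ⟨r, hr, hc⟩ :=
    ((Filter.eventually_ge_atTop 1).and f.eventually_isCompl_ker_pow_range_pow).exists
  set p := LinearMap.range (f ^ r)
  set q := LinearMap.ker (f ^ r)
  have hcomm (x : n → K) : (f ^ r) (f x) = f ((f ^ r) x) := by
    rw [← Module.End.mul_apply, ← Module.End.mul_apply, ← pow_succ, ← pow_succ']
  have hp : ∀ x ∈ p, f x ∈ p := by
    rintro _ ⟨y, rfl⟩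
    exact ⟨f y, hcomm y⟩
  have hq : ∀ x ∈ q, f x ∈ q := fun x hx => by
    rw [LinearMap.mem_ker] at hx ⊢
    rw [hcomm, hx, map_zero]
  let e := p.prodEquivOfIsCompl q hc.symm
  let bp := Module.finBasis K p
  let bq := Module.finBasis K q
  let b := Pi.basisFun K n
  have hinj : Function.Injective (f.restrict hp) := by
    rw [injective_iff_map_eq_zero]
    intro x hx
    have hfx : f x = 0 := congrArg Subtype.val hx
    have hxq : (x : n → K) ∈ q := by
      obtain ⟨s, rfl⟩ := Nat.exists_eq_add_of_le' hr
      rw [LinearMap.mem_ker, pow_succ, Module.End.mul_apply, hfx, map_zero]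
    exact Subtype.ext (Submodule.disjoint_def.1 hc.disjoint x hxq x.2)
  have hunit : IsUnit (f.restrict hp) :=
    (Module.End.isUnit_iff _).2 ⟨hinj, LinearMap.injective_iff_surjective.1 hinj⟩
  have hnil : IsNilpotent (f.restrict hq) := by
    refine ⟨r, ?_⟩
    ext1 x
    rw [Module.End.pow_restrict]
    exact Subtype.ext x.2
  refine ⟨_, _, LinearMap.toMatrix b (bp.prod bq) e.symm.toLinearMap,
    LinearMap.toMatrix (bp.prod bq) b e.toLinearMap,
    LinearMap.toMatrix bp bp (f.restrict hp), LinearMap.toMatrix bq bq (f.restrict hq),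
    ?_, ?_, ?_, ?_, ?_, ?_⟩
  · rw [Submodule.finrank_add_eq_of_isCompl hc.symm, Module.finrank_fintype_fun_eq_card]
  · rw [← LinearMap.toMatrix_comp, LinearEquiv.comp_coe, LinearEquiv.self_trans_symm,
      LinearEquiv.refl_toLinearMap, LinearMap.toMatrix_id]
  · rw [← LinearMap.toMatrix_comp, LinearEquiv.comp_coe, LinearEquiv.symm_trans_self,
      LinearEquiv.refl_toLinearMap, LinearMap.toMatrix_id]
  · exact hunit.map (LinearMap.toMatrixAlgEquiv bp)
  · exact hnil.map (LinearMap.toMatrixAlgEquiv bq)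
  · have hE : E = LinearMap.toMatrix b b f := by
      rw [hf]
      exact (LinearMap.toMatrix'_toLin' E).symm
    rw [← LinearMap.toMatrix_prodMap, hE, ← LinearMap.toMatrix_comp, ← LinearMap.toMatrix_comp]
    congr 1
    refine LinearMap.ext fun x => ?_
    simp only [LinearMap.comp_apply, LinearEquiv.coe_coe]
    rw [LinearEquiv.symm_apply_eq]
    simp [e]

/-- A matrix pencil `A₀ + A₁ X` of nonzero determinant over an infinite field specialises to an
invertible matrix at some point. -/
theorem Matrix.exists_isUnit_add_smul {K n : Type*} [Field K] [Infinite K] [Fintype n]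
    [DecidableEq n] (A₀ A₁ : Matrix n n K)
    (h : (A₀.map C + (X : K[X]) • A₁.map C).det ≠ 0) : ∃ c : K, IsUnit (A₀ + c • A₁) := by
  obtain ⟨c, hc⟩ : ∃ c, (A₀.map C + (X : K[X]) • A₁.map C).det.eval c ≠ 0 := by
    by_contra! h'
    exact h (Polynomial.funext fun c => by simpa using h' c)
  refine ⟨c, (Matrix.isUnit_iff_isUnit_det _).2 (isUnit_iff_ne_zero.2 ?_)⟩
  convert hc
  rw [← Polynomial.coe_evalRingHom, RingHom.map_det]
  congr 1
  ext i j
  simp [mul_comm c]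

/-- Making a full non-unit, non-monic linear matrix over `ℚ[x]` monic (right version):
there are an invertible scalar matrix `S'` and a unit `U'` of `ℚ[x]^{d×d}` with
`S'·L·U' = W' ⊕ I_{ℓ'}` for some monic full linear matrix `W'` of strictly smaller size. -/
theorem monicity_right (d : ℕ) (A₀ A₁ : Matrix (Fin d) (Fin d) ℚ)
    (L : Matrix (Fin d) (Fin d) ℚ[X])
    (hL : ∀ i j, L i j = Polynomial.C (A₀ i j) + Polynomial.C (A₁ i j) * X)
    (hfull : L.det ≠ 0)
    (hnonunit : ¬ ∃ c : ℚ, c ≠ 0 ∧ L.det = Polynomial.C c)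
    (hnonmonic : ¬ IsUnit A₁) :
    ∃ (ℓ' : ℕ) (hℓ' : ℓ' < d), 0 < ℓ' ∧
      ∃ (S' : Matrix (Fin d) (Fin d) ℚ) (U' : Matrix (Fin d) (Fin d) ℚ[X])
        (W' : Matrix (Fin (d - ℓ')) (Fin (d - ℓ')) ℚ[X])
        (B₀' B₁' : Matrix (Fin (d - ℓ')) (Fin (d - ℓ')) ℚ),
        IsUnit S' ∧ IsUnit U' ∧
        (∀ i j, W' i j = Polynomial.C (B₀' i j) + Polynomial.C (B₁' i j) * X) ∧
        IsUnit B₁' ∧ W'.det ≠ 0 ∧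
        S'.map Polynomial.C * L * U' =
          Matrix.reindex (finSumFinEquiv.trans (finCongr (Nat.sub_add_cancel hℓ'.le)))
            (finSumFinEquiv.trans (finCongr (Nat.sub_add_cancel hℓ'.le)))
            (Matrix.fromBlocks W' 0 0 (1 : Matrix (Fin ℓ') (Fin ℓ') ℚ[X])) := by
  have hLmat : L = A₀.map C + (X : ℚ[X]) • A₁.map C := by
    ext1 i j
    rw [hL, mul_comm]
    simp
  obtain ⟨c, hP⟩ := Matrix.exists_isUnit_add_smul A₀ A₁ (hLmat ▸ hfull)
  set P := A₀ + c • A₁ with hPdef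
  have hPdet := (Matrix.isUnit_iff_isUnit_det P).1 hP
  obtain ⟨m, k, Q, Q', E₁, N, hmk, hQQ', hQ'Q, hE₁, hN, hQE⟩ := Matrix.exists_fitting (P⁻¹ * A₁)
  rw [Fintype.card_fin] at hmk
  obtain rfl : m = d - k := by omega
  set t : ℚ[X] := X - C c
  set W : Matrix (Fin (d - k)) (Fin (d - k)) ℚ[X] := 1 + t • E₁.map C with hW
  have hLP : L = P.map C + t • A₁.map C := by
    rw [hLmat]
    ext1 i j
    simp [hPdef, t]
    ring
  have hSL : (Q * P⁻¹).map C * L * Q'.map C = Matrix.fromBlocks W 0 0 (1 + t • N.map C) := by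
    have h1 : (Q * P⁻¹).map C * P.map C * Q'.map C = (1 : Matrix _ _ ℚ[X]) := by
      rw [← Matrix.map_mul, ← Matrix.map_mul, Matrix.mul_assoc Q, Matrix.nonsing_inv_mul _ hPdet,
        Matrix.mul_one, hQQ']
      simp
    have h2 : (Q * P⁻¹).map C * A₁.map C * Q'.map C =
        (Matrix.fromBlocks E₁ 0 0 N).map (C : ℚ →+* ℚ[X]) := by
      rw [← Matrix.map_mul, ← Matrix.map_mul, Matrix.mul_assoc Q, hQE]
    rw [hLP, Matrix.mul_add, Matrix.add_mul, Matrix.mul_smul, Matrix.smul_mul, h1, h2,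
      Matrix.fromBlocks_map, Matrix.fromBlocks_smul, ← Matrix.fromBlocks_one,
      Matrix.fromBlocks_add]
    simp [hW]
  have hV : IsUnit (1 + t • N.map C) :=
    ((hN.map (C : ℚ →+* ℚ[X]).mapMatrix).smul t).isUnit_one_add
  obtain ⟨V, hV1, -⟩ := isUnit_iff_exists.1 hV
  have hk : k ≤ d := by omega
  let e : Fin (d - k) ⊕ Fin k ≃ Fin d := finSumFinEquiv.trans (finCongr (Nat.sub_add_cancel hk))
  set S : Matrix (Fin d) (Fin d) ℚ := (Q * P⁻¹).submatrix e.symm id with hS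
  set D : Matrix (Fin (d - k) ⊕ Fin k) (Fin (d - k) ⊕ Fin k) ℚ[X] :=
    Matrix.fromBlocks 1 0 0 V with hD
  set D' : Matrix (Fin (d - k) ⊕ Fin k) (Fin (d - k) ⊕ Fin k) ℚ[X] :=
    Matrix.fromBlocks 1 0 0 (1 + t • N.map C) with hD'
  have hD'D : D' * D = 1 := by simp [hD, hD', Matrix.fromBlocks_multiply, hV1]
  set Qp : Matrix (Fin (d - k) ⊕ Fin k) (Fin d) ℚ[X] := Q.map C with hQp
  set Qp' : Matrix (Fin d) (Fin (d - k) ⊕ Fin k) ℚ[X] := Q'.map C with hQp'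
  have hQp_mul : Qp * Qp' = 1 := by
    rw [hQp, hQp', ← Matrix.map_mul, hQQ']
    simp
  set U : Matrix (Fin d) (Fin d) ℚ[X] := (Qp' * D).submatrix id e.symm with hU
  have hSunit : IsUnit S := by
    refine IsUnit.of_mul_eq_one ((P * Q').submatrix id e.symm) ?_
    rw [hS, ← Matrix.submatrix_mul _ _ _ _ _ Function.bijective_id, Matrix.mul_assoc Q,
      ← Matrix.mul_assoc P⁻¹, Matrix.nonsing_inv_mul _ hPdet, Matrix.one_mul, hQQ',
      Matrix.submatrix_one_equiv]
  have hUunit : IsUnit U := by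
    refine IsUnit.of_mul_eq_one_right ((D' * Qp).submatrix e.symm id) ?_
    rw [hU, ← Matrix.submatrix_mul _ _ _ _ _ Function.bijective_id, Matrix.mul_assoc,
      ← Matrix.mul_assoc Qp, hQp_mul, Matrix.one_mul, hD'D, Matrix.submatrix_one_equiv]
  have hSLU : S.map C * L * U =
      (Matrix.fromBlocks W 0 0 (1 : Matrix (Fin k) (Fin k) ℚ[X])).submatrix e.symm e.symm := by
    have hS' : S.map C * L = ((Q * P⁻¹).map C * L).submatrix e.symm id := by
      rw [hS, ← Matrix.submatrix_map, ← Matrix.submatrix_mul_equiv _ _ _ (Equiv.refl _)]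
      rfl
    rw [hS', hU, ← Matrix.submatrix_mul _ _ _ _ _ Function.bijective_id, ← Matrix.mul_assoc, hSL,
      hD, Matrix.fromBlocks_multiply]
    simp [hV1]
  have hdet : (S.map C).det * L.det * U.det = W.det := by
    rw [← Matrix.det_mul, ← Matrix.det_mul, hSLU, Matrix.det_submatrix_equiv_self,
      Matrix.det_fromBlocks_zero₂₁, Matrix.det_one, mul_one]
  have hSdet : IsUnit (S.map C).det :=
    (Matrix.isUnit_iff_isUnit_det _).1 (hSunit.map (C : ℚ →+* ℚ[X]).mapMatrix)
  have hUdet : IsUnit U.det := (Matrix.isUnit_iff_isUnit_det _).1 hUunit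
  have hkd : k < d := by
    refine lt_of_le_of_ne hk fun hkd => ?_
    have : IsEmpty (Fin (d - k)) := by
      rw [hkd, Nat.sub_self]
      infer_instance
    have hWdet : IsUnit ((S.map C).det * L.det * U.det) := by
      rw [hdet, Matrix.det_isEmpty (A := W)]
      exact isUnit_one
    have hLu : IsUnit L.det := isUnit_of_mul_isUnit_right (isUnit_of_mul_isUnit_left hWdet)
    obtain ⟨a, ha, hae⟩ := Polynomial.isUnit_iff.1 hLu
    exact hnonunit ⟨a, ha.ne_zero, hae.symm⟩
  have hkpos : 0 < k := by
    refine Nat.pos_of_ne_zero fun hk0 => hnonmonic ?_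
    have : IsEmpty (Fin k) := by
      rw [hk0]
      infer_instance
    obtain ⟨F, hF, -⟩ := isUnit_iff_exists.1 hE₁
    set G : Matrix (Fin (d - k) ⊕ Fin k) (Fin (d - k) ⊕ Fin k) ℚ :=
      Matrix.fromBlocks F 0 0 1 with hG
    have hE : P⁻¹ * A₁ * (Q' * G * Q) = 1 := by
      calc P⁻¹ * A₁ * (Q' * G * Q)
          = Q' * Q * (P⁻¹ * A₁ * (Q' * G * Q)) := by
            rw [hQ'Q, Matrix.one_mul]
        _ = Q' * (Q * (P⁻¹ * A₁) * Q' * G) * Q := by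
            simp only [Matrix.mul_assoc]
        _ = 1 := by
            rw [hQE, hG, Matrix.fromBlocks_multiply, Subsingleton.elim N 1]
            simp [hF, hQ'Q]
    have hA₁ : A₁ = P * (P⁻¹ * A₁) := by
      rw [← Matrix.mul_assoc, Matrix.mul_nonsing_inv _ hPdet, Matrix.one_mul]
    rw [hA₁]
    exact hP.mul (IsUnit.of_mul_eq_one _ hE)
  refine ⟨k, hkd, hkpos, S, U, W, 1 - c • E₁, E₁, hSunit, hUunit, fun i j => ?_, hE₁, ?_, hSLU⟩
  · have h1 : (1 : Matrix (Fin (d - k)) (Fin (d - k)) ℚ[X]) i j =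
        C ((1 : Matrix (Fin (d - k)) (Fin (d - k)) ℚ) i j) := by
      simp only [Matrix.one_apply]
      split_ifs <;> simp
    rw [hW, Matrix.add_apply, h1]
    simp [t]
    ring
  · rw [← hdet]
    exact mul_ne_zero (mul_ne_zero hSdet.ne_zero hfull) hUdet.ne_zero
end

section
/- Let f ∈ ℚ[X] be a monic irreducible polynomial of degree k, and let B ∈ ℚ^{n×n} be a matrix whose characteristic polynomial is f^ℓ and whose minimal polynomial is f^e with e ≥ 2. For 1 ≤ j ≤ e let U_j = ker(f(B)^j) ⊆ ℚⁿ. Then for each j with 2 ≤ j ≤ e: the endomorphism B̄ induced by B on the quotient space U_j / U_{j−1} satisfies f(B̄) = 0, and U_j / U_{j−1} is an internal direct sum of B̄-invariant subspaces each of dimension k; in particular k divides dim U_j − dim U_{j−1}. -/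
open Polynomial

/-- Polynomials in endomorphisms intertwined by a linear map are intertwined by it as well. -/
theorem LinearMap.map_aeval_apply_of_intertwine {R M N : Type*} [CommSemiring R]
    [AddCommMonoid M] [Module R M] [AddCommMonoid N] [Module R N]
    (φ : M →ₗ[R] N) (S : Module.End R M) (T : Module.End R N) (h : ∀ v, φ (S v) = T (φ v))
    (g : R[X]) (v : M) : φ (aeval S g v) = aeval T g (φ v) := by
  induction g using Polynomial.induction_on' with
  | add p q hp hq => simp [hp, hq]
  | monomial m a =>
    have hpow : ∀ m v, φ ((S ^ m) v) = (T ^ m) (φ v) := by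
      intro m
      induction m with
      | zero => simp
      | succ m ih => intro v; simp [pow_succ, ih, h]
    simp [aeval_monomial, Module.algebraMap_end_apply, hpow]

/-- A vector space over a field extension `L / K`, finite-dimensional over `K`, is the internal
direct sum of finitely many `L`-subspaces of `K`-dimension `[L : K]`. -/
theorem exists_iSupIndep_submodule_finrank_eq_of_isScalarTower (K L V : Type*) [Field K] [Field L]
    [Algebra K L] [AddCommGroup V] [Module K V] [Module L V] [IsScalarTower K L V]
    [Module.Finite K V] :
    ∃ (t : ℕ) (W : Fin t → Submodule L V),
      (∀ i, Module.finrank K (W i) = Module.finrank K L) ∧ iSupIndep W ∧ ⨆ i, W i = ⊤ := by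
  have : Module.Finite L V := Module.Finite.of_restrictScalars_finite K L V
  let b := Module.finBasis L V
  refine ⟨_, fun i ↦ Submodule.span L {b i}, fun i ↦ ?_,
    b.linearIndependent.iSupIndep_span_singleton, ?_⟩
  · rw [← Module.finrank_mul_finrank K L, finrank_span_singleton (b.ne_zero i), mul_one]
  · rw [← Submodule.span_range_eq_iSup, b.span_eq]

/-- If an endomorphism `T` is annihilated by an irreducible polynomial `f`, the space is the
internal direct sum of `T`-invariant subspaces of dimension `deg f`. -/
theorem Module.End.exists_iSupIndep_invariant_of_aeval_eq_zero {K V : Type*} [Field K]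
    [AddCommGroup V] [Module K V] [Module.Finite K V] (T : Module.End K V) {f : K[X]}
    (hf : Irreducible f) (hT : aeval T f = 0) :
    ∃ (t : ℕ) (W : Fin t → Submodule K V),
      (∀ i, Module.finrank K (W i) = f.natDegree) ∧ (∀ i, ∀ x ∈ W i, T x ∈ W i) ∧
      iSupIndep W ∧ ⨆ i, W i = ⊤ := by
  have : Fact (Irreducible f) := ⟨hf⟩
  let φ : AdjoinRoot f →ₐ[K] Module.End K V := Ideal.Quotient.liftₐ (Ideal.span {f}) (aeval T) fun g hg ↦ by
    obtain ⟨c, rfl⟩ := Ideal.mem_span_singleton.mp hg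
    rw [map_mul, hT, zero_mul]
  have hφ : φ (AdjoinRoot.root f) = T := aeval_X T
  let _ : Module (AdjoinRoot f) V := Module.compHom V φ.toRingHom
  have smul_def (a : AdjoinRoot f) (v : V) : a • v = φ a v := rfl
  have : IsScalarTower K (AdjoinRoot f) V := ⟨fun c a v ↦ by simp [smul_def]⟩
  obtain ⟨t, W, hdim, hind, hsup⟩ :=
    exists_iSupIndep_submodule_finrank_eq_of_isScalarTower K (AdjoinRoot f) V
  refine ⟨t, fun i ↦ (W i).restrictScalars K, fun i ↦ ?_, fun i x hx ↦ ?_, fun i ↦ ?_, ?_⟩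
  · rw [← AdjoinRoot.powerBasis_dim hf.ne_zero, ← PowerBasis.finrank]
    exact hdim i
  · have hroot : T x = AdjoinRoot.root f • x := by
      rw [smul_def, hφ]
    rw [hroot]
    exact (W i).smul_mem _ hx
  · simpa only [← Submodule.restrictScalars_iSup, Submodule.disjoint_restrictScalars_iff]
      using hind i
  · rw [← Submodule.restrictScalars_iSup, hsup, Submodule.restrictScalars_top]

/-- Let `f ∈ ℚ[X]` be monic irreducible of degree `k` and let `B ∈ ℚ^{n×n}` have
characteristic polynomial `f^ℓ` and minimal polynomial `f^e` with `e ≥ 2`. For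
`U_j = ker (f(B)^j)` and `2 ≤ j ≤ e`, the endomorphism `B̄` induced by `B` on the quotient
`U_j / U_{j−1}` satisfies `f(B̄) = 0`, and the quotient is an internal direct sum of
`B̄`-invariant subspaces each of dimension `k`; in particular `k ∣ dim U_j − dim U_{j−1}`. -/
theorem quotient_decomposes_into_invariant_subspaces (n k ℓ e : ℕ) (f : ℚ[X])
    (hmonic : f.Monic) (hirr : Irreducible f) (hdeg : f.natDegree = k)
    (B : Matrix (Fin n) (Fin n) ℚ)
    (hchar : B.charpoly = f ^ ℓ) (hmin : minpoly ℚ B = f ^ e) (he : 2 ≤ e)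
    (U : ℕ → Submodule ℚ (Fin n → ℚ))
    (hU : ∀ j, U j = LinearMap.ker ((Polynomial.aeval B f ^ j).mulVecLin))
    (j : ℕ) (hj2 : 2 ≤ j) (hje : j ≤ e)
    (Bbar : (↥(U j) ⧸ (U (j - 1)).comap (U j).subtype) →ₗ[ℚ]
            (↥(U j) ⧸ (U (j - 1)).comap (U j).subtype))
    (hBbar : ∀ v w : ↥(U j), (w : Fin n → ℚ) = B.mulVecLin (v : Fin n → ℚ) →
      Bbar (Submodule.Quotient.mk v) = Submodule.Quotient.mk w) :
    Polynomial.aeval (Bbar : Module.End ℚ (↥(U j) ⧸ (U (j - 1)).comap (U j).subtype)) f = 0 ∧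
    (∃ (t : ℕ) (W : Fin t → Submodule ℚ (↥(U j) ⧸ (U (j - 1)).comap (U j).subtype)),
      (∀ i, Module.finrank ℚ (W i) = k) ∧
      (∀ i, ∀ x ∈ W i, Bbar x ∈ W i) ∧
      iSupIndep W ∧
      (⨆ i, W i) = ⊤) ∧
    k ∣ Module.finrank ℚ (U j) - Module.finrank ℚ (U (j - 1)) := by
  have hle : U (j - 1) ≤ U j := by
    rw [hU, hU]
    conv_rhs => rw [← Nat.sub_add_cancel (one_le_two.trans hj2), pow_succ', Matrix.mulVecLin_mul]
    exact LinearMap.ker_le_ker_comp _ _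
  have hcomm (i : ℕ) (g : ℚ[X]) (v : Fin n → ℚ) (hv : v ∈ U i) :
      (aeval B g).mulVecLin v ∈ U i := by
    rw [hU, LinearMap.mem_ker] at hv ⊢
    rw [← LinearMap.comp_apply, ← Matrix.mulVecLin_mul, ← map_pow,
      ← map_mul, mul_comm, map_mul, Matrix.mulVecLin_mul, LinearMap.comp_apply, map_pow, hv,
      map_zero]
  have hinv : ∀ v ∈ U j, B.mulVecLin v ∈ U j := fun v hv ↦ by simpa using hcomm j X v hv
  have hmat : aeval (B.mulVecLin : Module.End ℚ (Fin n → ℚ)) f = (aeval B f).mulVecLin :=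
    aeval_algHom_apply (Matrix.toLinAlgEquiv' : Matrix (Fin n) (Fin n) ℚ ≃ₐ[ℚ] _).toAlgHom B f
  have hzero : aeval (Bbar : Module.End ℚ (↥(U j) ⧸ (U (j - 1)).comap (U j).subtype)) f = 0 := by
    refine LinearMap.ext fun q ↦ ?_
    obtain ⟨v, rfl⟩ := Submodule.mkQ_surjective _ q
    rw [← LinearMap.map_aeval_apply_of_intertwine _ (B.mulVecLin.restrict hinv) Bbar
      (fun v ↦ (hBbar v _ rfl).symm), LinearMap.zero_apply, Submodule.mkQ_apply,
      Submodule.Quotient.mk_eq_zero, Submodule.mem_comap,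
      LinearMap.map_aeval_apply_of_intertwine (U j).subtype (B.mulVecLin.restrict hinv)
        B.mulVecLin (fun _ ↦ rfl), hmat, hU, LinearMap.mem_ker, ← LinearMap.comp_apply,
      ← Matrix.mulVecLin_mul, ← pow_succ, Nat.sub_add_cancel (one_le_two.trans hj2)]
    exact LinearMap.mem_ker.mp ((hU j).le v.2)
  obtain ⟨t, W, hdim, hWinv, hind, hsup⟩ :=
    Module.End.exists_iSupIndep_invariant_of_aeval_eq_zero _ hirr hzero
  rw [hdeg] at hdim
  refine ⟨hzero, ⟨t, W, hdim, hWinv, hind, hsup⟩, ?_⟩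
  have hint := (DirectSum.isInternal_submodule_iff_iSupIndep_and_iSup_eq_top W).mpr ⟨hind, hsup⟩
  have hquot : Module.finrank ℚ (↥(U j) ⧸ (U (j - 1)).comap (U j).subtype) = t * k := by
    rw [← (LinearEquiv.ofBijective (DirectSum.coeLinearMap W) hint).finrank_eq,
      Module.finrank_directSum]
    simp [hdim]
  rw [← (Submodule.comapSubtypeEquivOfLe hle).finrank_eq, ← Submodule.finrank_quotient, hquot]
  exact dvd_mul_left k t
end

section
/- Let M ∈ ℚ[x]^{d×d} be a matrix of univariate rational polynomials such that det M ≠ 0 and det M is not a nonzero constant (i.e., M is full and not a unit). Then there exist r ≥ 1 and matrices M₁, M₂, …, M_r ∈ ℚ[x]^{d×d}, each of which is an atom of the matrix ring ℚ[x]^{d×d}, such that M = M₁·M₂⋯M_r; moreover r ≤ deg(det M). -/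
open Polynomial

/-- A matrix over `ℚ[x]` is an *atom* if it is full (nonzero determinant), not a unit of the
matrix ring, and in any factorization `M = A·B` one of the factors is a unit. -/
def Matrix.IsAtomQx {d : ℕ} (M : Matrix (Fin d) (Fin d) ℚ[X]) : Prop :=
  M.det ≠ 0 ∧ ¬ IsUnit M ∧
    ∀ A B : Matrix (Fin d) (Fin d) ℚ[X], M = A * B → IsUnit A ∨ IsUnit B

/-- A full matrix over `ℚ[x]` is a unit exactly when its determinant has degree zero. -/
theorem Matrix.isUnit_iff_natDegree_det_eq_zero {d : ℕ} {M : Matrix (Fin d) (Fin d) ℚ[X]}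
    (hM : M.det ≠ 0) : IsUnit M ↔ M.det.natDegree = 0 := by
  rw [Matrix.isUnit_iff_isUnit_det, Polynomial.isUnit_iff_degree_eq_zero,
    ← Nat.cast_zero, Polynomial.degree_eq_iff_natDegree_eq hM]

/-- A full non-unit matrix over `ℚ[x]` is the product of a nonempty list of atoms whose length is
at most the degree of the determinant. -/
theorem Matrix.exists_list_isAtomQx_prod_eq {d : ℕ} (M : Matrix (Fin d) (Fin d) ℚ[X])
    (hM : M.det ≠ 0) (hunit : ¬ IsUnit M) :
    ∃ l : List (Matrix (Fin d) (Fin d) ℚ[X]),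
      l ≠ [] ∧ (∀ A ∈ l, A.IsAtomQx) ∧ M = l.prod ∧ l.length ≤ M.det.natDegree := by
  induction hn : M.det.natDegree using Nat.strong_induction_on generalizing M with
  | _ n ih =>
    by_cases hatom : M.IsAtomQx
    · have hdeg := mt (isUnit_iff_natDegree_det_eq_zero hM).2 hunit
      exact ⟨[M], by simp, by simpa using hatom, by simp, by simp; omega⟩
    · have hred : ∃ A B : Matrix (Fin d) (Fin d) ℚ[X], M = A * B ∧ ¬ IsUnit A ∧ ¬ IsUnit B := by
        by_contra! h
        exact hatom ⟨hM, hunit, fun A B hAB => or_iff_not_imp_left.2 (h A B hAB)⟩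
      obtain ⟨A, B, rfl, hA, hB⟩ := hred
      rw [Matrix.det_mul] at hM hn
      have hA0 := left_ne_zero_of_mul hM
      have hB0 := right_ne_zero_of_mul hM
      rw [Polynomial.natDegree_mul hA0 hB0] at hn
      have hAdeg := mt (isUnit_iff_natDegree_det_eq_zero hA0).2 hA
      have hBdeg := mt (isUnit_iff_natDegree_det_eq_zero hB0).2 hB
      obtain ⟨l₁, hne, hl₁, rfl, hlen₁⟩ := ih _ (by omega) A hA0 hA rfl
      obtain ⟨l₂, -, hl₂, rfl, hlen₂⟩ := ih _ (by omega) B hB0 hB rfl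
      refine ⟨l₁ ++ l₂, by simp [hne], fun C hC => ?_, List.prod_append.symm, ?_⟩
      · exact (List.mem_append.1 hC).elim (hl₁ C) (hl₂ C)
      · rw [List.length_append]
        omega

/-- Every full non-unit matrix `M ∈ ℚ[x]^{d×d}` admits a complete factorization
`M = M₁·M₂⋯M_r` into atoms, with `r ≤ deg (det M)`. -/
theorem matrix_factorization_Qx (d : ℕ) (M : Matrix (Fin d) (Fin d) ℚ[X])
    (hfull : M.det ≠ 0)
    (hnonunit : ¬ ∃ c : ℚ, c ≠ 0 ∧ M.det = Polynomial.C c) :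
    ∃ (r : ℕ) (_ : 1 ≤ r) (Ms : Fin r → Matrix (Fin d) (Fin d) ℚ[X]),
      (∀ i, Matrix.IsAtomQx (Ms i)) ∧ M = (List.ofFn Ms).prod ∧
      r ≤ M.det.natDegree := by
  have hunit : ¬ IsUnit M := fun h => by
    obtain ⟨c, hc, hM⟩ := Polynomial.isUnit_iff.1 ((Matrix.isUnit_iff_isUnit_det M).1 h)
    exact hnonunit ⟨c, hc.ne_zero, hM.symm⟩
  obtain ⟨l, hne, hatom, hprod, hlen⟩ := M.exists_list_isAtomQx_prod_eq hfull hunit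
  exact ⟨l.length, List.length_pos_iff.2 hne, l.get, fun i => hatom _ (l.get_mem i),
    by rwa [List.ofFn_get], hlen⟩
end
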